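/- Let d > 4. There exist β0 > 0 and constants c, C > 0 such that for all β ∈ (0, β0]: χ(z) ≠ 0 for all z ∈ ℂ with |z| < z_c; the function F(z) = 1/χ(z) and its complex derivative F' extend continuously from the open disk |z| < z_c to the closed disk |z| ≤ z_c; the extensions satisfy F(z_c) = 0, |F'(z) + 2d| ≤ C β for all |z| ≤ z_c, and |−z_c F'(z_c) − 1| ≤ C β; and |F(z)| ≥ c |1 − z/z_c| for all |z| ≤ z_c. -/

import Mathlib

open scoped BigOperators

/-- A unit step in `ℤ^d`: a coordinate direction together with a sign. -/
def wsawStep (d : ℕ) (e : Fin d × Bool) : Fin d → ℤ :=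
  fun i => if i = e.1 then (if e.2 then 1 else -1) else 0

/-- The position after `k` steps of the walk on `ℤ^d` with step sequence `s`.
(An `n`-step nearest-neighbour walk on `ℤ^d` started at `0` is the same thing as a
sequence of `n` unit steps.) -/
def wsawPos {d n : ℕ} (s : Fin n → Fin d × Bool) (k : ℕ) : Fin d → ℤ :=
  ∑ j ∈ Finset.univ.filter (fun j : Fin n => (j : ℕ) < k), wsawStep d (s j)

/-- The weakly self-avoiding walk weight `∏_{0 ≤ s < t ≤ n} (1 + β U_{st}(ω))`
of the `ℤ^d` walk with step sequence `s`. -/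
noncomputable def wsawWeight {d : ℕ} (β : ℝ) (n : ℕ) (s : Fin n → Fin d × Bool) : ℝ :=
  ∏ p ∈ (Finset.range (n + 1) ×ˢ Finset.range (n + 1)).filter (fun p => p.1 < p.2),
    (1 + β * (if wsawPos s p.1 = wsawPos s p.2 then (-1 : ℝ) else 0))

/-- The two-point partition function `c_n(x)` on `ℤ^d`. -/
noncomputable def cZx (d : ℕ) (β : ℝ) (n : ℕ) (x : Fin d → ℤ) : ℝ :=
  ∑ s ∈ Finset.univ.filter (fun s : Fin n → Fin d × Bool => wsawPos s n = x),
    wsawWeight β n s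

/-- The partition function `c_n = Σ_x c_n(x)` on `ℤ^d`. -/
noncomputable def cZ (d : ℕ) (β : ℝ) (n : ℕ) : ℝ :=
  ∑ s : Fin n → Fin d × Bool, wsawWeight β n s

/-- The position after `k` steps of the torus walk with step sequence `s`:
the mod-`r` projection of the `ℤ^d` position (for `r ≥ 3`, `n`-step torus walks
started at `0` correspond bijectively to step sequences). -/
def wsawPosT {d : ℕ} (r : ℕ) {n : ℕ} (s : Fin n → Fin d × Bool) (k : ℕ) : Fin d → ZMod r :=
  fun i => ((wsawPos s k i : ℤ) : ZMod r)

/-- The weakly self-avoiding walk weight of the torus walk with step sequence `s`. -/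
noncomputable def wsawWeightT {d : ℕ} (r : ℕ) (β : ℝ) (n : ℕ) (s : Fin n → Fin d × Bool) : ℝ :=
  ∏ p ∈ (Finset.range (n + 1) ×ˢ Finset.range (n + 1)).filter (fun p => p.1 < p.2),
    (1 + β * (if wsawPosT r s p.1 = wsawPosT r s p.2 then (-1 : ℝ) else 0))

/-- The torus partition function `c_n^𝕋`. -/
noncomputable def cT (d r : ℕ) (β : ℝ) (n : ℕ) : ℝ :=
  ∑ s : Fin n → Fin d × Bool, wsawWeightT r β n s

/-- `μ` is the growth constant: `μ = lim_{n→∞} c_n^{1/n}`. -/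
def HasGrowthConst (d : ℕ) (β μ : ℝ) : Prop :=
  Filter.Tendsto (fun n : ℕ => (cZ d β n) ^ ((n : ℝ)⁻¹)) Filter.atTop (nhds μ)

/-- The susceptibility `χ(z)` on `ℤ^d`, for complex `z`. -/
noncomputable def chi (d : ℕ) (β : ℝ) (z : ℂ) : ℂ := ∑' n : ℕ, (cZ d β n : ℂ) * z ^ n

/-- The susceptibility `χ(z)` on `ℤ^d`, for real `z`. -/
noncomputable def chiR (d : ℕ) (β : ℝ) (z : ℝ) : ℝ := ∑' n : ℕ, cZ d β n * z ^ n

/-- The torus susceptibility `χ^𝕋(z)`, for complex `z`. -/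
noncomputable def chiT (d r : ℕ) (β : ℝ) (z : ℂ) : ℂ := ∑' n : ℕ, (cT d r β n : ℂ) * z ^ n

/-- The torus susceptibility `χ^𝕋(z)`, for real `z`. -/
noncomputable def chiTR (d r : ℕ) (β : ℝ) (z : ℝ) : ℝ := ∑' n : ℕ, cT d r β n * z ^ n

/-- The sup norm `‖x‖_∞` of `x ∈ ℤ^d`, as a real number. -/
noncomputable def nInf {d : ℕ} (x : Fin d → ℤ) : ℝ :=
  ((Finset.univ.sup fun i => (x i).natAbs : ℕ) : ℝ)

/-- `⟨x⟩ = max {1, ‖x‖_∞}`. -/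
noncomputable def vee {d : ℕ} (x : Fin d → ℤ) : ℝ := max 1 (nInf x)

/-- The two-point function `G_z(x) = Σ_n c_n(x) z^n` on `ℤ^d`. -/
noncomputable def Gpt (d : ℕ) (β z : ℝ) (x : Fin d → ℤ) : ℝ := ∑' n : ℕ, cZx d β n x * z ^ n

/-- The bubble diagram `B_z = G_z * G_z`. -/
noncomputable def Bpt (d : ℕ) (β z : ℝ) (x : Fin d → ℤ) : ℝ :=
  ∑' y : Fin d → ℤ, Gpt d β z (x - y) * Gpt d β z y

/-- The triangle diagram `T_z = G_z * G_z * G_z`. -/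
noncomputable def Tpt (d : ℕ) (β z : ℝ) (x : Fin d → ℤ) : ℝ :=
  ∑' y : Fin d → ℤ, Bpt d β z (x - y) * Gpt d β z y

/-- The representative in `[-r/2, r/2) ∩ ℤ` of `x ∈ ℤ/rℤ`. -/
def repC (r : ℕ) (x : ZMod r) : ℤ :=
  if 2 * (x.val : ℤ) < (r : ℤ) then (x.val : ℤ) else (x.val : ℤ) - (r : ℤ)

namespace WSAW
open Finset

/-- The product of `u s t` over all pairs `a ≤ s < t ≤ b`. -/
def pairProd (u : ℕ → ℕ → ℝ) (a b : ℕ) : ℝ := ∏ t ∈ Ioc a b, ∏ s ∈ Ico a t, u s t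

/-- The product of `u s t` over all pairs `a ≤ s < t ≤ n` with `b < t`, or `b ≤ s`. -/
def crossProd (u : ℕ → ℕ → ℝ) (n a b : ℕ) : ℝ :=
  (∏ t ∈ Ioc b n, ∏ s ∈ Ico a b, u s t) * pairProd u b n

/-- The coefficients of the lace expansion, truncated to laces with fewer than `f` edges. -/
def laceCoeff (u : ℕ → ℕ → ℝ) : ℕ → ℕ → ℕ → ℕ → ℝ
  | 0, _, _, _ => 0
  | f + 1, a, b, m => (if m = b then 1 else 0) +
      ∑ t ∈ Ioc b m, ((∏ s ∈ Ico a b, u s t) - 1) * (∏ t' ∈ Ioo b t, ∏ s ∈ Ico a b, u s t') *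
        pairProd u b t * laceCoeff u f b t m

/-- The nonnegative majorant of `laceCoeff`. -/
def laceBound (u : ℕ → ℕ → ℝ) : ℕ → ℕ → ℕ → ℕ → ℝ
  | 0, _, _, _ => 0
  | f + 1, a, b, m => (if m = b then 1 else 0) +
      ∑ t ∈ Ioc b m, (∑ s ∈ Ico a b, (1 - u s t)) * pairProd u b t * laceBound u f b t m

lemma pairProd_self (u : ℕ → ℕ → ℝ) (a : ℕ) : pairProd u a a = 1 := by simp [pairProd]

lemma pairProd_split (u : ℕ → ℕ → ℝ) {a b n : ℕ} (hab : a ≤ b) (hbn : b ≤ n) :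
    pairProd u a n = pairProd u a b * crossProd u n a b := by
  unfold pairProd crossProd pairProd
  rw [← prod_Ioc_consecutive _ hab hbn, ← prod_mul_distrib]
  congr 1
  refine prod_congr rfl fun t ht => ?_
  rw [mem_Ioc] at ht
  rw [prod_Ico_consecutive _ hab ht.1.le]

lemma prod_Ioc_telescope (v : ℕ → ℝ) (b n : ℕ) (h : b ≤ n) :
    ∏ t ∈ Ioc b n, v t = 1 + ∑ t ∈ Ioc b n, (v t - 1) * ∏ t' ∈ Ioo b t, v t' := by
  induction n, h using Nat.le_induction with
  | base => simp
  | succ n hn ih =>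
    rw [← Finset.insert_Ioc_right_eq_Ioc_add_one hn, prod_insert (by simp), sum_insert (by simp)]
    have : Ioo b (n + 1) = Ioc b n := by ext; simp
    rw [this]
    linear_combination ih

lemma crossProd_step (u : ℕ → ℕ → ℝ) {a b n : ℕ} (hbn : b ≤ n) :
    crossProd u n a b = pairProd u b n +
      ∑ t ∈ Ioc b n, ((∏ s ∈ Ico a b, u s t) - 1) * (∏ t' ∈ Ioo b t, ∏ s ∈ Ico a b, u s t') *
        pairProd u b t * crossProd u n b t := by
  rw [crossProd, prod_Ioc_telescope (fun t => ∏ s ∈ Ico a b, u s t) b n hbn, add_mul, one_mul,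
    sum_mul]
  congr 1
  refine sum_congr rfl fun t ht => ?_
  rw [mem_Ioc] at ht
  rw [pairProd_split u ht.1.le ht.2]
  ring

lemma crossProd_eq_sum (u : ℕ → ℕ → ℝ) (f : ℕ) : ∀ {a b n : ℕ}, b ≤ n → n < b + f →
    crossProd u n a b = ∑ m ∈ Icc b n, laceCoeff u f a b m * pairProd u m n := by
  induction f with
  | zero => intro a b n h1 h2; omega
  | succ f ih =>
    intro a b n h1 h2
    rw [crossProd_step u h1]
    simp only [laceCoeff, add_mul, sum_add_distrib, ite_mul, one_mul, zero_mul, sum_mul]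
    rw [sum_ite_eq' (Icc b n) b, if_pos (by simp [h1])]
    congr 1
    rw [sum_comm' (t' := Ioc b n) (s' := fun t => Icc t n)
      (by intro x y; simp only [mem_Icc, mem_Ioc]; omega)]
    refine sum_congr rfl fun t ht => ?_
    rw [mem_Ioc] at ht
    rw [ih ht.2 (by omega), mul_sum]
    exact sum_congr rfl fun m _ => by ring

lemma laceCoeff_stable (u : ℕ → ℕ → ℝ) (f : ℕ) : ∀ (g a b m : ℕ), m < b + f → m < b + g →
    laceCoeff u f a b m = laceCoeff u g a b m := by
  induction f with
  | zero =>
    intro g a b m h1 h2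
    cases g with
    | zero => rfl
    | succ g =>
      have : Ioc b m = ∅ := by ext; simp; omega
      simp [laceCoeff, this, show m ≠ b by omega]
  | succ f ih =>
    intro g a b m h1 h2
    cases g with
    | zero =>
      have : Ioc b m = ∅ := by ext; simp; omega
      simp [laceCoeff, this, show m ≠ b by omega]
    | succ g =>
      simp only [laceCoeff]
      congr 1
      refine sum_congr rfl fun t ht => ?_
      rw [mem_Ioc] at ht
      rw [ih g b t m (by omega) (by omega)]

/-- The convolution form of the lace expansion. -/
lemma pairProd_eq_sum (u : ℕ → ℕ → ℝ) {n : ℕ} (hn : 1 ≤ n) (hu : u 0 1 = 1) :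
    pairProd u 0 n = ∑ m ∈ Icc 1 n, laceCoeff u m 0 1 m * pairProd u m n := by
  rw [pairProd_split u zero_le_one hn, crossProd_eq_sum u n hn (by omega)]
  have : pairProd u 0 1 = 1 := by simp [pairProd, hu]
  rw [this, one_mul]
  refine sum_congr rfl fun m hm => ?_
  rw [mem_Icc] at hm
  rw [laceCoeff_stable u n m 0 1 m (by omega) (by omega)]

lemma pairProd_congr {u u' : ℕ → ℕ → ℝ} {a b : ℕ} (h : ∀ s t, t ≤ b → s < t → u s t = u' s t) :
    pairProd u a b = pairProd u' a b := by
  refine prod_congr rfl fun t ht => prod_congr rfl fun s hs => ?_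
  simp only [mem_Ioc, mem_Ico] at ht hs
  exact h s t ht.2 hs.2

lemma laceCoeff_congr {u u' : ℕ → ℕ → ℝ} {m : ℕ} (h : ∀ s t, t ≤ m → s < t → u s t = u' s t)
    (f : ℕ) : ∀ a b, laceCoeff u f a b m = laceCoeff u' f a b m := by
  induction f with
  | zero => intros; rfl
  | succ f ih =>
    intro a b
    simp only [laceCoeff]
    congr 1
    refine sum_congr rfl fun t ht => ?_
    rw [mem_Ioc] at ht
    rw [ih b t, pairProd_congr (u' := u') (fun s t' h1 h2 => h s t' (h1.trans ht.2) h2)]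
    congr 3
    · congr 1
      refine prod_congr rfl fun s hs => h s t ht.2 ?_
      rw [mem_Ico] at hs; omega
    · refine prod_congr rfl fun t' ht' => prod_congr rfl fun s hs => h s t' ?_ ?_
      · rw [mem_Ioo] at ht'; omega
      · rw [mem_Ioo] at ht'; rw [mem_Ico] at hs; omega

lemma pairProd_shift (u : ℕ → ℕ → ℝ) (a b c : ℕ) :
    pairProd (fun s t => u (s + c) (t + c)) a b = pairProd u (a + c) (b + c) := by
  unfold pairProd
  rw [← image_add_right_Ioc, prod_image (by simp)]
  refine prod_congr rfl fun t _ => ?_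
  rw [← image_add_right_Ico, prod_image (by simp)]

lemma laceBound_shift (u : ℕ → ℕ → ℝ) (c f : ℕ) : ∀ a b m : ℕ,
    laceBound (fun s t => u (s + c) (t + c)) f a b m = laceBound u f (a + c) (b + c) (m + c) := by
  induction f with
  | zero => intros; rfl
  | succ f ih =>
    intro a b m
    simp only [laceBound, add_left_inj]
    congr 1
    rw [← image_add_right_Ioc, sum_image (by simp)]
    refine sum_congr rfl fun t _ => ?_
    rw [ih b t m, pairProd_shift, ← image_add_right_Ico, sum_image (by simp)]

lemma pairProd_nonneg {u : ℕ → ℕ → ℝ} (h0 : ∀ s t, 0 ≤ u s t) (a b : ℕ) : 0 ≤ pairProd u a b :=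
  prod_nonneg fun _ _ => prod_nonneg fun _ _ => h0 _ _

lemma pairProd_le_mul {u : ℕ → ℕ → ℝ} (h0 : ∀ s t, 0 ≤ u s t) (h1 : ∀ s t, u s t ≤ 1)
    {a b n : ℕ} (hab : a ≤ b) (hbn : b ≤ n) :
    pairProd u a n ≤ pairProd u a b * pairProd u b n := by
  rw [pairProd_split u hab hbn, crossProd]
  refine mul_le_mul_of_nonneg_left ?_ (pairProd_nonneg h0 _ _)
  refine mul_le_of_le_one_left (pairProd_nonneg h0 _ _) ?_
  exact prod_le_one (fun _ _ => prod_nonneg fun _ _ => h0 _ _)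
    fun _ _ => prod_le_one (fun _ _ => h0 _ _) fun _ _ => h1 _ _

lemma laceBound_nonneg {u : ℕ → ℕ → ℝ} (h0 : ∀ s t, 0 ≤ u s t) (h1 : ∀ s t, u s t ≤ 1)
    (f : ℕ) : ∀ a b m, 0 ≤ laceBound u f a b m := by
  induction f with
  | zero => intros; exact le_rfl
  | succ f ih =>
    intro a b m
    refine add_nonneg (by split_ifs <;> simp) (sum_nonneg fun t _ => ?_)
    exact mul_nonneg (mul_nonneg (sum_nonneg fun s _ => sub_nonneg.2 (h1 _ _))
      (pairProd_nonneg h0 _ _)) (ih _ _ _)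

lemma one_sub_prod_le_sum (s : Finset ℕ) (v : ℕ → ℝ) (h0 : ∀ i, 0 ≤ v i) (h1 : ∀ i, v i ≤ 1) :
    1 - ∏ i ∈ s, v i ≤ ∑ i ∈ s, (1 - v i) := by
  induction s using Finset.induction_on with
  | empty => simp
  | insert i s hi ih =>
    rw [prod_insert hi, sum_insert hi]
    have hp : ∏ j ∈ s, v j ≤ 1 := prod_le_one (fun j _ => h0 j) fun j _ => h1 j
    nlinarith [h0 i, h1 i]

lemma abs_laceCoeff_le {u : ℕ → ℕ → ℝ} (h0 : ∀ s t, 0 ≤ u s t) (h1 : ∀ s t, u s t ≤ 1)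
    (f : ℕ) : ∀ a b m, |laceCoeff u f a b m| ≤ laceBound u f a b m := by
  induction f with
  | zero => intros; simp [laceCoeff, laceBound]
  | succ f ih =>
    intro a b m
    simp only [laceCoeff, laceBound]
    refine (abs_add_le _ _).trans (add_le_add (by split_ifs <;> simp) ?_)
    refine (abs_sum_le_sum_abs _ _).trans (sum_le_sum fun t _ => ?_)
    rw [abs_mul, abs_mul, abs_mul, abs_of_nonneg (pairProd_nonneg h0 b t)]
    have hp : ∏ s ∈ Ico a b, u s t ≤ 1 := prod_le_one (fun _ _ => h0 _ _) fun _ _ => h1 _ _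
    have hq : |∏ t' ∈ Ioo b t, ∏ s ∈ Ico a b, u s t'| ≤ 1 := by
      rw [abs_of_nonneg (prod_nonneg fun _ _ => prod_nonneg fun _ _ => h0 _ _)]
      exact prod_le_one (fun _ _ => prod_nonneg fun _ _ => h0 _ _)
        fun _ _ => prod_le_one (fun _ _ => h0 _ _) fun _ _ => h1 _ _
    have hr : |(∏ s ∈ Ico a b, u s t) - 1| ≤ ∑ s ∈ Ico a b, (1 - u s t) := by
      rw [abs_sub_comm, abs_of_nonneg (by linarith)]
      exact one_sub_prod_le_sum _ (fun s => u s t) (fun s => h0 s t) (fun s => h1 s t)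
    have hr' := (abs_nonneg _).trans hr
    refine mul_le_mul (mul_le_mul_of_nonneg_right ?_ (pairProd_nonneg h0 b t)) (ih _ _ _)
      (abs_nonneg _) (mul_nonneg hr' (pairProd_nonneg h0 b t))
    exact (mul_le_mul hr hq (abs_nonneg _) hr').trans_eq (mul_one _)

lemma laceBound_mono_left {u : ℕ → ℕ → ℝ} (h0 : ∀ s t, 0 ≤ u s t) (h1 : ∀ s t, u s t ≤ 1)
    (f : ℕ) {a' a : ℕ} (h : a' ≤ a) (b m : ℕ) :
    laceBound u f a b m ≤ laceBound u f a' b m := by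
  cases f with
  | zero => exact le_rfl
  | succ f =>
    simp only [laceBound]
    gcongr with t _
    · exact laceBound_nonneg h0 h1 _ _ _ _
    · exact pairProd_nonneg h0 _ _
    · exact fun _ _ _ => sub_nonneg.2 (h1 _ _)

/-- The majorant of the lace coefficients entering the convolution equation. -/
lemma abs_laceCoeff_zero_one_le {u : ℕ → ℕ → ℝ} (h0 : ∀ s t, 1 / 2 ≤ u s t)
    (h1 : ∀ s t, u s t ≤ 1) (h01 : u 0 1 = 1) {f m : ℕ} (hm : 2 ≤ m) (hf : m < f) :
    |laceCoeff u m 0 1 m| ≤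
      2 * ∑ t ∈ Ioc 1 m, (1 - u 0 t) * pairProd u 0 t * laceBound u f 0 t m := by
  have h0' : ∀ s t, 0 ≤ u s t := fun s t => by linarith [h0 s t]
  obtain ⟨g, rfl⟩ : ∃ g, f = g + 1 := ⟨f - 1, by omega⟩
  rw [laceCoeff_stable u m (g + 2) 0 1 m (by omega) (by omega), laceCoeff,
    if_neg (by omega), zero_add, mul_sum]
  refine (abs_sum_le_sum_abs _ _).trans (sum_le_sum fun t ht => ?_)
  rw [mem_Ioc] at ht
  rw [abs_mul]
  have hb : |laceCoeff u (g + 1) 1 t m| ≤ laceBound u (g + 1) 0 t m :=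
    (abs_laceCoeff_le h0' h1 _ _ _ _).trans (laceBound_mono_left h0' h1 _ zero_le_one _ _)
  have hc : |((∏ s ∈ Ico 0 1, u s t) - 1) * (∏ t' ∈ Ioo 1 t, ∏ s ∈ Ico 0 1, u s t') *
      pairProd u 1 t| ≤ 2 * ((1 - u 0 t) * pairProd u 0 t) := by
    rw [pairProd_split u zero_le_one ht.1.le, crossProd]
    have e1 : pairProd u 0 1 = 1 := by simp [pairProd, h01]
    have e2 : Ioc 1 t = insert t (Ioo 1 t) := by
      ext; simp; omega
    rw [e1, e2, prod_insert (by simp)]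
    simp only [Nat.Ico_zero_eq_range, range_one, prod_singleton]
    have hA : 0 ≤ ∏ t' ∈ Ioo 1 t, u 0 t' := prod_nonneg fun _ _ => h0' _ _
    have hB := pairProd_nonneg h0' 1 t
    rw [abs_mul, abs_mul, abs_of_nonneg hA, abs_of_nonneg hB, abs_sub_comm,
      abs_of_nonneg (sub_nonneg.2 (h1 0 t))]
    have : 0 ≤ (1 - u 0 t) * (∏ t' ∈ Ioo 1 t, u 0 t') * pairProd u 1 t :=
      mul_nonneg (mul_nonneg (sub_nonneg.2 (h1 0 t)) hA) hB
    nlinarith [h0 0 t]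
  calc _ ≤ 2 * ((1 - u 0 t) * pairProd u 0 t) * laceBound u (g + 1) 0 t m :=
        mul_le_mul hc hb (abs_nonneg _) ((abs_nonneg _).trans hc)
    _ = _ := by ring

end WSAW

namespace WSAW
open Finset

/-- The displacement of a finite sequence of steps. -/
def endp {d : ℕ} (l : List (Fin d × Bool)) : Fin d → ℤ := (l.map (wsawStep d)).sum

/-- The interaction between two times of the walk with steps `l`. -/
noncomputable def interact {d : ℕ} (β : ℝ) (l : List (Fin d × Bool)) (s t : ℕ) : ℝ :=
  if endp (l.take s) = endp (l.take t) then 1 - β else 1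

/-- The weakly self-avoiding walk weight of a list of steps. -/
noncomputable def walkWeight {d : ℕ} (β : ℝ) (l : List (Fin d × Bool)) : ℝ :=
  pairProd (interact β l) 0 l.length

/-- The lace expansion weight of a list of steps, including the single step. -/
noncomputable def laceWeight {d : ℕ} (β : ℝ) (l : List (Fin d × Bool)) : ℝ :=
  laceCoeff (interact β l) l.length 0 1 l.length

/-- The majorant of the remainder of a lace when the walk `l₁` is already explored. -/
noncomputable def laceRem {d : ℕ} (β : ℝ) (f : ℕ) (l₁ l₂ : List (Fin d × Bool)) : ℝ :=
  laceBound (interact β (l₁ ++ l₂)) f 0 l₁.length (l₁.length + l₂.length)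

/-- Reverse the direction of every step. -/
def flipSteps {d : ℕ} (l : List (Fin d × Bool)) : List (Fin d × Bool) :=
  l.map fun e => (e.1, !e.2)

section
variable {d : ℕ} {β : ℝ}

@[simp] lemma endp_nil : endp ([] : List (Fin d × Bool)) = 0 := rfl

lemma endp_cons (e : Fin d × Bool) (l) : endp (e :: l) = wsawStep d e + endp l := by
  simp [endp]

lemma endp_append (l l' : List (Fin d × Bool)) : endp (l ++ l') = endp l + endp l' := by
  simp [endp]

lemma wsawStep_ne_zero (e : Fin d × Bool) : wsawStep d e ≠ 0 := by
  intro h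
  have := congrFun h e.1
  simp only [wsawStep, if_true, Pi.zero_apply] at this
  split_ifs at this
  all_goals omega

lemma flipSteps_length (l : List (Fin d × Bool)) : (flipSteps l).length = l.length := by
  simp [flipSteps]

lemma flipSteps_flipSteps (l : List (Fin d × Bool)) : flipSteps (flipSteps l) = l := by
  simp [flipSteps, Function.comp_def]

lemma endp_flipSteps (l : List (Fin d × Bool)) : endp (flipSteps l) = -endp l := by
  induction l with
  | nil => simp [flipSteps]
  | cons e l ih =>
    have : flipSteps (e :: l) = (e.1, !e.2) :: flipSteps l := rfl
    rw [this, endp_cons, endp_cons, ih, neg_add]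
    congr 1
    funext i
    rcases e with ⟨e, b⟩
    cases b <;> (simp [wsawStep]; split_ifs <;> simp)

lemma interact_flipSteps (l : List (Fin d × Bool)) : interact β (flipSteps l) = interact β l := by
  funext s t
  have h : ∀ k, (flipSteps l).take k = flipSteps (l.take k) := fun k => by
    simp [flipSteps, List.map_take]
  simp only [interact, h, endp_flipSteps, neg_inj]

lemma walkWeight_flipSteps (l : List (Fin d × Bool)) :
    walkWeight β (flipSteps l) = walkWeight β l := by
  rw [walkWeight, walkWeight, interact_flipSteps, flipSteps_length]

lemma laceWeight_flipSteps (l : List (Fin d × Bool)) :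
    laceWeight β (flipSteps l) = laceWeight β l := by
  rw [laceWeight, laceWeight, interact_flipSteps, flipSteps_length]

lemma interact_le_one (hβ : 0 ≤ β) (l : List (Fin d × Bool)) (s t : ℕ) : interact β l s t ≤ 1 := by
  unfold interact; split_ifs <;> linarith

lemma half_le_interact (hβ : β ≤ 1 / 2) (l : List (Fin d × Bool)) (s t : ℕ) :
    1 / 2 ≤ interact β l s t := by
  unfold interact; split_ifs <;> linarith

lemma interact_nonneg (hβ : β ≤ 1) (l : List (Fin d × Bool)) (s t : ℕ) : 0 ≤ interact β l s t := by
  unfold interact; split_ifs <;> linarith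

lemma interact_take (l : List (Fin d × Bool)) {m s t : ℕ} (ht : t ≤ m) (hs : s < t) :
    interact β (l.take m) s t = interact β l s t := by
  simp [interact, List.take_take, ht, (hs.trans_le ht).le]

lemma interact_drop (l : List (Fin d × Bool)) (m s t : ℕ) :
    interact β (l.drop m) s t = interact β l (s + m) (t + m) := by
  simp only [interact]
  have h : ∀ k, endp (l.take (k + m)) = endp (l.take m) + endp ((l.drop m).take k) := fun k => by
    rw [← endp_append, add_comm k m, List.take_add]
  simp only [h, add_right_inj]

lemma interact_zero_one {l : List (Fin d × Bool)} (hl : l ≠ []) : interact β l 0 1 = 1 := by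
  cases l with
  | nil => exact absurd rfl hl
  | cons e l =>
    rw [interact, if_neg]
    simp [endp_cons, (wsawStep_ne_zero e).symm]

@[simp] lemma walkWeight_nil : walkWeight β ([] : List (Fin d × Bool)) = 1 := pairProd_self _ _

@[simp] lemma laceWeight_nil : laceWeight β ([] : List (Fin d × Bool)) = 0 := rfl

lemma laceWeight_of_length_one {l : List (Fin d × Bool)} (hl : l.length = 1) :
    laceWeight β l = 1 := by
  simp [laceWeight, hl, laceCoeff]

lemma walkWeight_nonneg (hβ : β ≤ 1) (l : List (Fin d × Bool)) : 0 ≤ walkWeight β l :=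
  pairProd_nonneg (interact_nonneg hβ l) _ _

lemma walkWeight_take (l : List (Fin d × Bool)) {m : ℕ} (hm : m ≤ l.length) :
    walkWeight β (l.take m) = pairProd (interact β l) 0 m := by
  rw [walkWeight, List.length_take, min_eq_left hm]
  exact pairProd_congr fun s t ht hs => interact_take l ht hs

lemma walkWeight_drop (l : List (Fin d × Bool)) {m : ℕ} (hm : m ≤ l.length) :
    walkWeight β (l.drop m) = pairProd (interact β l) m l.length := by
  have : interact β (l.drop m) = fun s t => interact β l (s + m) (t + m) := by
    funext s t; exact interact_drop l m s t
  rw [walkWeight, this, pairProd_shift, List.length_drop, zero_add, Nat.sub_add_cancel hm]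

lemma walkWeight_append_le (h0 : 0 ≤ β) (h1 : β ≤ 1) (l l' : List (Fin d × Bool)) :
    walkWeight β (l ++ l') ≤ walkWeight β l * walkWeight β l' := by
  have h : l.length ≤ (l ++ l').length := by simp
  have e1 := walkWeight_take (β := β) (l ++ l') h
  have e2 := walkWeight_drop (β := β) (l ++ l') h
  rw [List.take_left'  rfl] at e1
  rw [List.drop_left' rfl] at e2
  rw [e1, e2]
  exact pairProd_le_mul (interact_nonneg h1 _) (interact_le_one h0 _) (Nat.zero_le _) h

lemma laceWeight_take (l : List (Fin d × Bool)) {m : ℕ} (hm : m ≤ l.length) :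
    laceWeight β (l.take m) = laceCoeff (interact β l) m 0 1 m := by
  rw [laceWeight, List.length_take, min_eq_left hm]
  exact laceCoeff_congr (fun s t ht hs => interact_take l ht hs) _ _ _

lemma walkWeight_eq_sum (l : List (Fin d × Bool)) :
    walkWeight β l = (if l = [] then 1 else 0) +
      ∑ m ∈ range (l.length + 1), laceWeight β (l.take m) * walkWeight β (l.drop m) := by
  by_cases hl : l = []
  · subst hl; simp
  · have hn : 1 ≤ l.length := List.length_pos_iff.2 hl
    rw [if_neg hl, zero_add, sum_range_succ', List.take_zero, laceWeight_nil, zero_mul, add_zero,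
      walkWeight, pairProd_eq_sum _ hn (interact_zero_one hl), range_eq_Ico,
      sum_Ico_add' (fun m => laceWeight β (l.take m) * walkWeight β (l.drop m)) 0 l.length 1]
    have : Ico (0 + 1) (l.length + 1) = Icc 1 l.length := by ext; simp
    rw [this]
    refine sum_congr rfl fun m hm => ?_
    rw [mem_Icc] at hm
    rw [laceWeight_take l hm.2, walkWeight_drop l hm.2]

lemma laceRem_nonneg (h0 : 0 ≤ β) (h1 : β ≤ 1) (f : ℕ) (l₁ l₂ : List (Fin d × Bool)) :
    0 ≤ laceRem β f l₁ l₂ :=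
  laceBound_nonneg (interact_nonneg h1 _) (interact_le_one h0 _) _ _ _ _

lemma abs_laceWeight_le (h0 : 0 ≤ β) (h1 : β ≤ 1 / 2) {f : ℕ} {l : List (Fin d × Bool)}
    (hl : 2 ≤ l.length) (hf : l.length < f) :
    |laceWeight β l| ≤ 2 * ∑ t ∈ range (l.length + 1), (if endp (l.take t) = 0 then β else 0) *
      walkWeight β (l.take t) * laceRem β f (l.take t) (l.drop t) := by
  have hl' : l ≠ [] := by rintro rfl; simp at hl
  refine (abs_laceCoeff_zero_one_le (half_le_interact h1 l) (interact_le_one h0 l)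
    (interact_zero_one hl') hl hf).trans ?_
  gcongr 2 * ?_
  have hsub : Ioc 1 l.length ⊆ range (l.length + 1) := fun t ht => by
    simp only [mem_Ioc, mem_range] at ht ⊢; omega
  refine (sum_le_sum fun t ht => ?_).trans (sum_le_sum_of_subset_of_nonneg hsub fun t _ _ => ?_)
  · rw [mem_Ioc] at ht
    rw [walkWeight_take l ht.2, laceRem, List.take_append_drop, List.length_take, List.length_drop,
      min_eq_left ht.2, Nat.add_sub_cancel' ht.2]
    refine le_of_eq ?_
    congr 2
    by_cases h : endp (l.take t) = 0
    · simp [interact, h]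
    · simp [interact, h, Ne.symm h]
  · refine mul_nonneg (mul_nonneg (by split_ifs <;> simp [h0]) (walkWeight_nonneg (by linarith) _))
      (laceRem_nonneg h0 (by linarith) _ _ _)

lemma laceRem_succ_le (h0 : 0 ≤ β) (h1 : β ≤ 1) (f : ℕ) (l₁ l₂ : List (Fin d × Bool)) :
    laceRem β (f + 1) l₁ l₂ ≤ (if l₂ = [] then 1 else 0) +
      ∑ j ∈ range (l₂.length + 1), ∑ i ∈ range (l₁.length + 1),
        (if endp (l₁.drop i) + endp (l₂.take j) = 0 then β else 0) *
          (walkWeight β (l₂.take j) * laceRem β f (l₂.take j) (l₂.drop j)) := by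
  rw [laceRem, laceBound]
  refine add_le_add (by simp) ?_
  set n := l₁.length with hn
  have hnn : ∀ i j, 0 ≤ (if endp (l₁.drop i) + endp (l₂.take j) = 0 then β else 0) *
          (walkWeight β (l₂.take j) * laceRem β f (l₂.take j) (l₂.drop j)) := fun i j =>
    mul_nonneg (by split_ifs <;> simp [h0])
      (mul_nonneg (walkWeight_nonneg h1 _) (laceRem_nonneg h0 h1 _ _ _))
  have e1 : Ioc n (n + l₂.length) = (Ioc 0 l₂.length).image (· + n) := by
    rw [image_add_right_Ioc]; simp [add_comm]
  rw [e1, sum_image (by simp)]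
  refine (sum_le_sum fun j hj => ?_).trans
    (sum_le_sum_of_subset_of_nonneg (s := Ioc 0 l₂.length) ?_ fun j _ _ => ?_)
  · rw [sum_mul, sum_mul]
    refine (sum_le_sum fun i hi => ?_).trans
      (sum_le_sum_of_subset_of_nonneg (s := Ico 0 n) ?_ fun i _ _ => hnn i j)
    · rw [mem_Ioc] at hj
      rw [mem_Ico] at hi
      rw [mul_assoc]
      have hI : (fun s t => interact β (l₁ ++ l₂) (s + n) (t + n)) = interact β l₂ := by
        funext s t
        rw [← interact_drop, List.drop_left' hn.symm]
      have k1 : pairProd (interact β (l₁ ++ l₂)) n (j + n) = walkWeight β (l₂.take j) := by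
        rw [walkWeight_take l₂ hj.2, ← hI, pairProd_shift, zero_add]
      have k2 : laceBound (interact β (l₁ ++ l₂)) f n (j + n) (n + l₂.length) =
          laceRem β f (l₂.take j) (l₂.drop j) := by
        rw [laceRem, List.take_append_drop, List.length_take, List.length_drop, min_eq_left hj.2,
          Nat.add_sub_cancel' hj.2, ← hI, laceBound_shift, zero_add, add_comm l₂.length]
      rw [k1, k2]
      refine le_of_eq ?_
      congr 1
      have p1 : (l₁ ++ l₂).take i = l₁.take i := by
        rw [List.take_append_of_le_length (by omega)]
      have p2 : endp ((l₁ ++ l₂).take (j + n)) =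
          endp (l₁.take i) + (endp (l₁.drop i) + endp (l₂.take j)) := by
        rw [add_comm j n, hn, List.take_length_add_append, ← add_assoc, ← endp_append,
          List.take_append_drop, endp_append]
      rw [interact, p1, p2]
      by_cases h : endp (l₁.drop i) + endp (l₂.take j) = 0
      · simp [h]
      · have : ¬ endp (l₁.take i) = endp (l₁.take i) + (endp (l₁.drop i) + endp (l₂.take j)) := by
          simpa using h
        simp only [if_neg h, if_neg this, sub_self]
    · intro i; simp only [mem_Ico, mem_range]; omega
  · intro i; simp only [mem_Ioc, mem_range]; omega
  · exact sum_nonneg fun i _ => hnn i j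

lemma sum_abs_endp_le (l : List (Fin d × Bool)) : ∑ i, |endp l i| ≤ l.length := by
  induction l with
  | nil => simp
  | cons e l ih =>
    have h : ∑ i, |wsawStep d e i| = 1 := by
      rw [Finset.sum_eq_single e.1]
      · simp only [wsawStep, if_true]; split_ifs <;> simp
      · intro i _ hi; simp [wsawStep, hi]
      · simp
    calc ∑ i, |endp (e :: l) i| ≤ ∑ i, (|wsawStep d e i| + |endp l i|) := by
          rw [endp_cons]; exact sum_le_sum fun i _ => abs_add_le _ _
      _ ≤ _ := by rw [sum_add_distrib, h]; push_cast [List.length_cons]; linarith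

lemma wsawPos_eq_endp {n : ℕ} (s : Fin n → Fin d × Bool) (k : ℕ) :
    wsawPos s k = endp ((List.ofFn s).take k) := by
  induction n generalizing k with
  | zero => simp [wsawPos]
  | succ n ih =>
    cases k with
    | zero => simp [wsawPos]
    | succ k =>
      rw [List.ofFn_succ, List.take_succ_cons, endp_cons, ← ih, wsawPos, wsawPos, sum_filter,
        sum_filter, Fin.sum_univ_succ]
      simp

lemma wsawWeight_eq_walkWeight {n : ℕ} (s : Fin n → Fin d × Bool) :
    wsawWeight β n s = walkWeight β (List.ofFn s) := by
  rw [wsawWeight, walkWeight, pairProd, prod_sigma', List.length_ofFn]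
  refine prod_nbij' (fun p => ⟨p.2, p.1⟩) (fun p => (p.2, p.1)) ?_ ?_ (fun _ _ => rfl)
    (fun _ _ => rfl) ?_
  · rintro ⟨a, b⟩ h
    simp only [mem_filter, mem_product, mem_range, mem_sigma, mem_Ioc, mem_Ico] at h ⊢
    omega
  · rintro ⟨a, b⟩ h
    simp only [mem_filter, mem_product, mem_range, mem_sigma, mem_Ioc, mem_Ico] at h ⊢
    omega
  · rintro ⟨a, b⟩ _
    simp only [interact, wsawPos_eq_endp]
    split_ifs <;> ring

end

end WSAW

namespace WSAW
open Finset
open scoped ENNReal NNReal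

section split
variable {α : Type*}

/-- Cutting a list in two at a given position. -/
lemma bijective_splitAt : Function.Bijective
    (fun p : (Σ l : List α, Fin (l.length + 1)) => (p.1.take p.2, p.1.drop p.2)) := by
  constructor
  · rintro ⟨l, i⟩ ⟨l', i'⟩ h
    simp only [Prod.mk.injEq] at h
    have hl : l = l' := by
      rw [← List.take_append_drop i l, ← List.take_append_drop i' l', h.1, h.2]
    subst hl
    have := congrArg List.length h.1
    simp only [List.length_take] at this
    have : i = i' := Fin.ext (by omega)
    subst this; rfl
  · rintro ⟨a, b⟩
    refine ⟨⟨a ++ b, ⟨a.length, by simp⟩⟩, by simp⟩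

/-- The pairs of lists as lists together with a cutting position. -/
noncomputable def splitEquiv : (Σ l : List α, Fin (l.length + 1)) ≃ List α × List α :=
  Equiv.ofBijective _ bijective_splitAt

lemma tsum_split (F : List α → List α → ℝ≥0∞) :
    ∑' l : List α, ∑ i ∈ range (l.length + 1), F (l.take i) (l.drop i) = ∑' a, ∑' b, F a b := by
  rw [← ENNReal.tsum_prod, ← splitEquiv.tsum_eq, ENNReal.tsum_sigma']
  refine tsum_congr fun l => ?_
  rw [tsum_fintype, Finset.sum_range]
  rfl

end split

section correlation
variable {Z : Type*} [AddCommGroup Z]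

lemma ENNReal_mul_le_sq_add_sq (a b : ℝ≥0∞) : a * b ≤ a ^ 2 + b ^ 2 := by
  rcases le_total a b with h | h
  · calc a * b ≤ b * b := by gcongr
      _ ≤ _ := by rw [sq b]; exact le_add_self
  · calc a * b ≤ a * a := by gcongr
      _ ≤ _ := by rw [sq a]; exact le_self_add

lemma tsum_correlation_le {G : Z → ℝ≥0∞} {B : ℝ≥0∞} (hB : ∑' x, G x ^ 2 ≤ B) (p q : Z) :
    ∑' v, G (p + v) * G (q + v) ≤ 2 * B := by
  calc ∑' v, G (p + v) * G (q + v) ≤ ∑' v, (G (p + v) ^ 2 + G (q + v) ^ 2) :=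
        ENNReal.tsum_le_tsum fun v => ENNReal_mul_le_sq_add_sq _ _
    _ = ∑' v, G v ^ 2 + ∑' v, G v ^ 2 := by
        rw [ENNReal.tsum_add]
        congr 1
        · exact (Equiv.addLeft p).tsum_eq fun v => G v ^ 2
        · exact (Equiv.addLeft q).tsum_eq fun v => G v ^ 2
    _ ≤ 2 * B := by rw [two_mul]; gcongr

/-- The bubble bound for the ladder of lace diagrams. -/
lemma ladder_bound {G H : Z → ℝ≥0∞} {β B D : ℝ≥0} (hB : ∑' x, G x ^ 2 ≤ B)
    (hH : ∀ x, H x ≤ D) (hβ : 64 * (β * B) ≤ 1) {x y : ℕ → Z → ℝ≥0∞}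
    (hx0 : ∀ v, x 0 v = 0) (hy0 : ∀ v, y 0 v = 0)
    (hx : ∀ f v, x (f + 1) v ≤ G v + β * ∑' a, G a * (G (v + a) * x f a))
    (hy : ∀ f v, y (f + 1) v ≤ H v + 4 * (β * ∑' a, G a * (H (v + a) * x f a)) +
      4 * (β * ∑' a, H a * (G (v + a) * x f a)) + 2 * (β * ∑' a, G a * (G (v + a) * y f a)))
    (f : ℕ) (v : Z) : y f v ≤ 2 * D := by
  have hcorr := tsum_correlation_le hB
  have hs : ∀ f p, ∑' v, G (p + v) * x f v ≤ ((4 * B : ℝ≥0) : ℝ≥0∞) := by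
    intro f
    induction f with
    | zero => intro p; simp [hx0]
    | succ f ih =>
      intro p
      calc ∑' v, G (p + v) * x (f + 1) v
          ≤ ∑' v, G (p + v) * (G v + β * ∑' a, G a * (G (v + a) * x f a)) :=
            ENNReal.tsum_le_tsum fun v => by gcongr; exact hx f v
        _ = ∑' v, G (p + v) * G (0 + v) +
            β * ∑' a, (G a * x f a) * ∑' v, G (p + v) * G (a + v) := by
            simp only [mul_add, ENNReal.tsum_add, zero_add]
            congr 1
            simp only [← ENNReal.tsum_mul_left]
            rw [ENNReal.tsum_comm]
            refine tsum_congr fun a => tsum_congr fun v => ?_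
            rw [add_comm v a]; ring
        _ ≤ 2 * B + β * ∑' a, (G (0 + a) * x f a) * (2 * B) := by
            simp only [zero_add]
            gcongr with a
            · simpa using hcorr p 0
            · exact hcorr p a
        _ ≤ 2 * B + β * (((4 * B : ℝ≥0) : ℝ≥0∞) * (2 * B)) := by
            rw [ENNReal.tsum_mul_right]; gcongr; exact ih 0
        _ ≤ ((4 * B : ℝ≥0) : ℝ≥0∞) := by
            norm_cast
            rw [← NNReal.coe_le_coe] at hβ ⊢
            push_cast at hβ ⊢
            nlinarith [B.coe_nonneg, β.coe_nonneg]
  induction f generalizing v with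
  | zero => simp [hy0]
  | succ f ih =>
    have t1 : ∑' a, G a * (H (v + a) * x f a) ≤ D * ((4 * B : ℝ≥0) : ℝ≥0∞) := by
      calc _ ≤ ∑' a, D * (G (0 + a) * x f a) := ENNReal.tsum_le_tsum fun a => by
            rw [zero_add, mul_left_comm]; gcongr; exact hH _
        _ ≤ _ := by rw [ENNReal.tsum_mul_left]; gcongr; exact hs f 0
    have t2 : ∑' a, H a * (G (v + a) * x f a) ≤ D * ((4 * B : ℝ≥0) : ℝ≥0∞) := by
      calc _ ≤ ∑' a, D * (G (v + a) * x f a) := ENNReal.tsum_le_tsum fun a => by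
            gcongr; exact hH _
        _ ≤ _ := by rw [ENNReal.tsum_mul_left]; gcongr; exact hs f v
    have t3 : ∑' a, G a * (G (v + a) * y f a) ≤ (2 * B) * (2 * D) := by
      calc _ ≤ ∑' a, (G (0 + a) * G (v + a)) * (2 * D) := ENNReal.tsum_le_tsum fun a => by
            rw [zero_add, ← mul_assoc]; gcongr; exact ih _
        _ ≤ _ := by rw [ENNReal.tsum_mul_right]; gcongr; exact hcorr _ _
    calc y (f + 1) v ≤ D + 4 * (β * (D * ((4 * B : ℝ≥0) : ℝ≥0∞))) +
          4 * (β * (D * ((4 * B : ℝ≥0) : ℝ≥0∞))) + 2 * (β * ((2 * B) * (2 * D))) := by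
          refine (hy f v).trans ?_
          gcongr
          exact hH v
      _ ≤ 2 * D := by
          norm_cast
          rw [← NNReal.coe_le_coe] at hβ ⊢
          push_cast at hβ ⊢
          nlinarith [D.coe_nonneg, mul_le_mul_of_nonneg_right hβ D.coe_nonneg]

end correlation

variable {d : ℕ}

/-- The weight of a walk in the generating function with activity `z`. -/
noncomputable def actWeight (β z : ℝ) (l : List (Fin d × Bool)) : ℝ≥0∞ :=
  ENNReal.ofReal (walkWeight β l) * ENNReal.ofReal z ^ l.length

/-- Number of steps plus squared displacement. -/
def momentWeight (l : List (Fin d × Bool)) : ℕ := l.length + ∑ i, (endp l i).natAbs ^ 2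

lemma momentWeight_append_le (l l' : List (Fin d × Bool)) :
    momentWeight (l ++ l') ≤ 2 * momentWeight l + 2 * momentWeight l' := by
  have : ∑ i, (endp (l ++ l') i).natAbs ^ 2 ≤
      2 * ∑ i, (endp l i).natAbs ^ 2 + 2 * ∑ i, (endp l' i).natAbs ^ 2 := by
    rw [mul_sum, mul_sum, ← sum_add_distrib]
    refine sum_le_sum fun i _ => ?_
    rw [endp_append]
    zify
    simp only [sq_abs, Pi.add_apply]
    nlinarith [sq_nonneg (endp l i - endp l' i)]
  simp only [momentWeight, List.length_append]
  omega

lemma momentWeight_flipSteps (l : List (Fin d × Bool)) :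
    momentWeight (flipSteps l) = momentWeight l := by
  simp [momentWeight, flipSteps_length, endp_flipSteps]

/-- The generating function of walks from `0` to `x`, with weight `φ`. -/
noncomputable def twoPoint (β z : ℝ) (φ : List (Fin d × Bool) → ℝ≥0∞) (x : Fin d → ℤ) : ℝ≥0∞ :=
  ∑' l, if endp l = x then actWeight β z l * φ l else 0

/-- The generating function of ladder diagrams. -/
noncomputable def ladder (β z : ℝ) (f : ℕ) (φ : List (Fin d × Bool) → ℝ≥0∞) (v : Fin d → ℤ) :
    ℝ≥0∞ :=
  ∑' l₁, ∑' l₂, if endp l₁ = v then actWeight β z l₁ *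
    (ENNReal.ofReal (laceRem β f l₁ l₂) * ENNReal.ofReal z ^ l₂.length * φ (l₁ ++ l₂)) else 0

lemma actWeight_append_le {β z : ℝ} (h0 : 0 ≤ β) (h1 : β ≤ 1) (l l' : List (Fin d × Bool)) :
    actWeight β z (l ++ l') ≤ actWeight β z l * actWeight β z l' := by
  unfold actWeight
  calc _ ≤ ENNReal.ofReal (walkWeight β l * walkWeight β l') *
        ENNReal.ofReal z ^ (l ++ l').length := by
        gcongr; exact walkWeight_append_le h0 h1 l l'
    _ = _ := by
        rw [ENNReal.ofReal_mul (walkWeight_nonneg h1 _), List.length_append, pow_add]; ring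

lemma tsum_actWeight_mul (β z : ℝ) (φ : List (Fin d × Bool) → ℝ≥0∞) (Ψ : (Fin d → ℤ) → ℝ≥0∞) :
    ∑' l, actWeight β z l * φ l * Ψ (endp l) = ∑' x, twoPoint β z φ x * Ψ x := by
  simp only [twoPoint, ← ENNReal.tsum_mul_right, ite_mul, zero_mul]
  rw [ENNReal.tsum_comm]
  refine tsum_congr fun l => ?_
  rw [tsum_eq_single (endp l)]
  · simp
  · intro x hx; rw [if_neg (Ne.symm hx)]

lemma twoPoint_neg (β z : ℝ) {φ : List (Fin d × Bool) → ℝ≥0∞} (hφ : ∀ l, φ (flipSteps l) = φ l)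
    (x : Fin d → ℤ) : twoPoint β z φ (-x) = twoPoint β z φ x := by
  have hinv : Function.Involutive (flipSteps (d := d)) := flipSteps_flipSteps
  unfold twoPoint
  rw [← hinv.toPerm.tsum_eq]
  refine tsum_congr fun l => ?_
  simp only [Function.Involutive.coe_toPerm, endp_flipSteps, neg_inj, actWeight,
    walkWeight_flipSteps, flipSteps_length, hφ]

lemma ladder_succ_le {β z : ℝ} (h0 : 0 ≤ β) (h1 : β ≤ 1) (f : ℕ)
    (φ : List (Fin d × Bool) → ℝ≥0∞) (v : Fin d → ℤ) :
    ladder β z (f + 1) φ v ≤ twoPoint β z φ v + ENNReal.ofReal β *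
      ∑' c, actWeight β z c * ∑' a, if endp a = v - endp c then
        actWeight β z a * ladder β z f (fun l => φ (a ++ c ++ l)) (-endp c) else 0 := by
  set A : List (Fin d × Bool) → List (Fin d × Bool) → ℝ≥0∞ := fun a c =>
    if endp a = v - endp c then actWeight β z a * actWeight β z c else 0 with hA
  set C : List (Fin d × Bool) → List (Fin d × Bool) → List (Fin d × Bool) →
      List (Fin d × Bool) → ℝ≥0∞ := fun a c b e =>
    (if endp b = -endp c then actWeight β z b * (ENNReal.ofReal (laceRem β f b e) *
      ENNReal.ofReal z ^ e.length * φ (a ++ c ++ (b ++ e))) else 0) with hC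
  have key : ∀ l₁ l₂, (if endp l₁ = v then actWeight β z l₁ *
      (ENNReal.ofReal (laceRem β (f + 1) l₁ l₂) * ENNReal.ofReal z ^ l₂.length * φ (l₁ ++ l₂))
      else 0) ≤ (if l₂ = [] then (if endp l₁ = v then actWeight β z l₁ * φ l₁ else 0) else 0) +
      ∑ j ∈ range (l₂.length + 1), ∑ i ∈ range (l₁.length + 1),
        ENNReal.ofReal β * (A (l₁.take i) (l₁.drop i) *
          C (l₁.take i) (l₁.drop i) (l₂.take j) (l₂.drop j)) := by
    intro l₁ l₂
    by_cases hv : endp l₁ = v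
    swap
    · simp [hv]
    have hw : ∀ i j, 0 ≤ (if endp (l₁.drop i) + endp (l₂.take j) = 0 then β else 0) *
          (walkWeight β (l₂.take j) * laceRem β f (l₂.take j) (l₂.drop j)) := fun i j =>
      mul_nonneg (by split_ifs <;> simp [h0])
        (mul_nonneg (walkWeight_nonneg h1 _) (laceRem_nonneg h0 h1 _ _ _))
    have hr : ENNReal.ofReal (laceRem β (f + 1) l₁ l₂) ≤ (if l₂ = [] then 1 else 0) +
        ∑ j ∈ range (l₂.length + 1), ∑ i ∈ range (l₁.length + 1),
        (if endp (l₁.drop i) + endp (l₂.take j) = 0 then ENNReal.ofReal β else 0) *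
          (ENNReal.ofReal (walkWeight β (l₂.take j)) *
            ENNReal.ofReal (laceRem β f (l₂.take j) (l₂.drop j))) := by
      refine (ENNReal.ofReal_le_ofReal (laceRem_succ_le h0 h1 f l₁ l₂)).trans
        (ENNReal.ofReal_add_le.trans (add_le_add (by split_ifs <;> simp) ?_))
      rw [ENNReal.ofReal_sum_of_nonneg (fun j _ => sum_nonneg fun i _ => hw i j)]
      refine sum_le_sum fun j _ => ?_
      rw [ENNReal.ofReal_sum_of_nonneg (fun i _ => hw i j)]
      refine sum_le_sum fun i _ => ?_
      rw [ENNReal.ofReal_mul (by split_ifs <;> simp [h0]),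
        ENNReal.ofReal_mul (walkWeight_nonneg h1 _)]
      gcongr
      split_ifs <;> simp
    rw [if_pos hv]
    calc _ ≤ actWeight β z l₁ * (((if l₂ = [] then 1 else 0) +
        ∑ j ∈ range (l₂.length + 1), ∑ i ∈ range (l₁.length + 1),
        (if endp (l₁.drop i) + endp (l₂.take j) = 0 then ENNReal.ofReal β else 0) *
          (ENNReal.ofReal (walkWeight β (l₂.take j)) *
            ENNReal.ofReal (laceRem β f (l₂.take j) (l₂.drop j)))) *
            ENNReal.ofReal z ^ l₂.length * φ (l₁ ++ l₂)) := by gcongr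
      _ = (if l₂ = [] then actWeight β z l₁ * φ l₁ else 0) +
        ∑ j ∈ range (l₂.length + 1), ∑ i ∈ range (l₁.length + 1), actWeight β z l₁ *
        ((if endp (l₁.drop i) + endp (l₂.take j) = 0 then ENNReal.ofReal β else 0) *
          (ENNReal.ofReal (walkWeight β (l₂.take j)) *
            ENNReal.ofReal (laceRem β f (l₂.take j) (l₂.drop j))) *
            ENNReal.ofReal z ^ l₂.length * φ (l₁ ++ l₂)) := by
          rw [add_mul, add_mul, mul_add]
          congr 1
          · split_ifs with h
            · simp [h]
            · simp
          · simp only [sum_mul, mul_sum]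
      _ ≤ _ := by
          rw [if_pos hv]
          refine add_le_add le_rfl (sum_le_sum fun j hj => sum_le_sum fun i _ => ?_)
          by_cases hb : endp (l₁.drop i) + endp (l₂.take j) = 0
          swap
          · rw [if_neg hb]; simp
          have hb' : endp (l₂.take j) = -endp (l₁.drop i) := eq_neg_of_add_eq_zero_right hb
          have ha' : endp (l₁.take i) = v - endp (l₁.drop i) := by
            rw [eq_sub_iff_add_eq, ← endp_append, List.take_append_drop, hv]
          have hle := actWeight_append_le (z := z) h0 h1 (l₁.take i) (l₁.drop i)
          rw [List.take_append_drop] at hle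
          rw [if_pos hb, hA, hC]
          simp only [if_pos ha', if_pos hb', List.take_append_drop]
          have hz : ENNReal.ofReal z ^ l₂.length =
              ENNReal.ofReal z ^ (l₂.take j).length * ENNReal.ofReal z ^ (l₂.drop j).length := by
            rw [← pow_add, ← List.length_append, List.take_append_drop]
          calc _ ≤ actWeight β z (l₁.take i) * actWeight β z (l₁.drop i) * (ENNReal.ofReal β *
            (ENNReal.ofReal (walkWeight β (l₂.take j)) *
            ENNReal.ofReal (laceRem β f (l₂.take j) (l₂.drop j))) *
            ENNReal.ofReal z ^ l₂.length * φ (l₁ ++ l₂)) := by gcongr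
            _ = _ := by rw [hz, show actWeight β z (l₂.take j) = ENNReal.ofReal (walkWeight β (l₂.take j)) *
                ENNReal.ofReal z ^ (l₂.take j).length from rfl]; ring
  unfold ladder
  calc _ ≤ _ := ENNReal.tsum_le_tsum fun l₁ => ENNReal.tsum_le_tsum fun l₂ => key l₁ l₂
    _ = twoPoint β z φ v + ∑' b, ∑' e, ∑' a, ∑' c, ENNReal.ofReal β * (A a c * C a c b e) := by
        simp only [ENNReal.tsum_add]
        congr 1
        · refine tsum_congr fun l => ?_
          rw [tsum_ite_eq]
        · rw [ENNReal.tsum_comm]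
          rw [← tsum_split fun b e => ∑' a, ∑' c, ENNReal.ofReal β * (A a c * C a c b e)]
          refine tsum_congr fun l₂ => ?_
          rw [Summable.tsum_finsetSum fun _ _ => ENNReal.summable]
          refine sum_congr rfl fun j _ => ?_
          rw [tsum_split fun a c => ENNReal.ofReal β *
            (A a c * C a c (l₂.take j) (l₂.drop j))]
    _ = _ := by
        congr 1
        have e1 : ∀ (b e : List (Fin d × Bool)),
            ∑' a, ∑' c, ENNReal.ofReal β * (A a c * C a c b e) =
            ∑' c, ∑' a, ENNReal.ofReal β * (A a c * C a c b e) := fun b e => ENNReal.tsum_comm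
        simp only [e1]
        have e2 : ∀ F : List (Fin d × Bool) → List (Fin d × Bool) → List (Fin d × Bool) →
            List (Fin d × Bool) → ℝ≥0∞, ∑' b, ∑' e, ∑' c, ∑' a, F c a b e =
            ∑' c, ∑' a, ∑' b, ∑' e, F c a b e := by
          intro F
          have s1 : ∀ b, ∑' e, ∑' c, ∑' a, F c a b e = ∑' c, ∑' a, ∑' e, F c a b e := fun b => by
            rw [ENNReal.tsum_comm]
            exact tsum_congr fun c => ENNReal.tsum_comm
          simp only [s1]
          rw [ENNReal.tsum_comm]
          exact tsum_congr fun c => ENNReal.tsum_comm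
        rw [e2 fun c a b e => ENNReal.ofReal β * (A a c * C a c b e)]
        simp only [ENNReal.tsum_mul_left]
        congr 1
        refine tsum_congr fun c => ?_
        rw [← ENNReal.tsum_mul_left]
        refine tsum_congr fun a => ?_
        rw [hA]
        by_cases ha : endp a = v - endp c
        · simp only [if_pos ha]
          ring
        · simp [ha]

end WSAW

namespace WSAW
open Finset
open scoped ENNReal NNReal

variable {d : ℕ} {β z : ℝ}

/-- `momentWeight` as an extended nonnegative real. -/
noncomputable def moment (l : List (Fin d × Bool)) : ℝ≥0∞ := momentWeight l

lemma moment_append_le (a c l : List (Fin d × Bool)) :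
    moment (a ++ c ++ l) ≤ 4 * moment a + 4 * moment c + 2 * moment l := by
  have h1 := momentWeight_append_le (a ++ c) l
  have h2 := momentWeight_append_le a c
  unfold moment
  norm_cast
  omega

lemma ladder_zero (β z : ℝ) (φ : List (Fin d × Bool) → ℝ≥0∞) (v : Fin d → ℤ) :
    ladder β z 0 φ v = 0 := by
  simp [ladder, laceRem, laceBound]

lemma ladder_moment_append_le (f : ℕ) (a c : List (Fin d × Bool)) (v : Fin d → ℤ) :
    ladder β z f (fun l => moment (a ++ c ++ l)) v ≤
      4 * moment a * ladder β z f (fun _ => 1) v + 4 * moment c * ladder β z f (fun _ => 1) v +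
      2 * ladder β z f moment v := by
  unfold ladder
  simp only [← ENNReal.tsum_mul_left, ← ENNReal.tsum_add]
  refine ENNReal.tsum_le_tsum fun l₁ => ENNReal.tsum_le_tsum fun l₂ => ?_
  split_ifs
  · calc _ ≤ actWeight β z l₁ * (ENNReal.ofReal (laceRem β f l₁ l₂) * ENNReal.ofReal z ^ l₂.length *
          (4 * moment a + 4 * moment c + 2 * moment (l₁ ++ l₂))) := by
          gcongr; exact moment_append_le _ _ _
      _ = _ := by ring
  · simp

lemma tsum_neg_arg (F : (Fin d → ℤ) → ℝ≥0∞) : ∑' x, F (-x) = ∑' x, F x :=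
  (Equiv.neg (Fin d → ℤ)).tsum_eq F

lemma ladder_one_succ_le (h0 : 0 ≤ β) (h1 : β ≤ 1) (f : ℕ) (v : Fin d → ℤ) :
    ladder β z (f + 1) (fun _ => 1) v ≤ twoPoint β z (fun _ => 1) v + ENNReal.ofReal β *
      ∑' a, twoPoint β z (fun _ => 1) a * (twoPoint β z (fun _ => 1) (v + a) *
        ladder β z f (fun _ => 1) a) := by
  refine (ladder_succ_le h0 h1 f _ v).trans (le_of_eq ?_)
  congr 2
  calc _ = ∑' c, actWeight β z c * 1 * (twoPoint β z (fun _ => 1) (v - endp c) *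
        ladder β z f (fun _ => 1) (-endp c)) := by
        refine tsum_congr fun c => ?_
        rw [mul_one]
        congr 1
        simp only [twoPoint, ← ENNReal.tsum_mul_right, ite_mul, zero_mul, mul_one]
    _ = _ := by
        rw [tsum_actWeight_mul β z (fun _ => 1) (fun x => twoPoint β z (fun _ => 1) (v - x) *
          ladder β z f (fun _ => 1) (-x)), ← tsum_neg_arg]
        refine tsum_congr fun x => ?_
        rw [twoPoint_neg β z (fun _ => rfl), neg_neg, sub_neg_eq_add]

lemma ladder_moment_succ_le (h0 : 0 ≤ β) (h1 : β ≤ 1) (f : ℕ) (v : Fin d → ℤ) :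
    ladder β z (f + 1) moment v ≤ twoPoint β z moment v +
      4 * (ENNReal.ofReal β * ∑' a, twoPoint β z (fun _ => 1) a *
        (twoPoint β z moment (v + a) * ladder β z f (fun _ => 1) a)) +
      4 * (ENNReal.ofReal β * ∑' a, twoPoint β z moment a *
        (twoPoint β z (fun _ => 1) (v + a) * ladder β z f (fun _ => 1) a)) +
      2 * (ENNReal.ofReal β * ∑' a, twoPoint β z (fun _ => 1) a *
        (twoPoint β z (fun _ => 1) (v + a) * ladder β z f moment a)) := by
  have hm : ∀ l : List (Fin d × Bool), moment (flipSteps l) = moment l := fun l => by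
    rw [moment, moment, momentWeight_flipSteps]
  refine (ladder_succ_le h0 h1 f _ v).trans ?_
  have e : ∀ (φ ψ χ : List (Fin d × Bool) → ℝ≥0∞), (∀ l, φ (flipSteps l) = φ l) →
      ∑' c, actWeight β z c * φ c * (twoPoint β z ψ (v - endp c) * ladder β z f χ (-endp c)) =
      ∑' a, twoPoint β z φ a * (twoPoint β z ψ (v + a) * ladder β z f χ a) := by
    intro φ ψ χ hφ
    rw [tsum_actWeight_mul β z φ (fun x => twoPoint β z ψ (v - x) * ladder β z f χ (-x)),
      ← tsum_neg_arg]
    refine tsum_congr fun x => ?_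
    rw [twoPoint_neg β z hφ, neg_neg, sub_neg_eq_add]
  rw [← e _ moment _ fun _ => rfl, ← e moment _ _ hm, ← e _ (fun _ => 1) moment fun _ => rfl]
  rw [add_assoc, add_assoc]
  refine add_le_add le_rfl ?_
  simp only [mul_left_comm _ (ENNReal.ofReal β), ← mul_add]
  gcongr
  simp only [← ENNReal.tsum_mul_left, ← ENNReal.tsum_add]
  refine ENNReal.tsum_le_tsum fun c => ?_
  calc _ ≤ actWeight β z c * ∑' a, if endp a = v - endp c then actWeight β z a *
        (4 * moment a * ladder β z f (fun _ => 1) (-endp c) +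
          4 * moment c * ladder β z f (fun _ => 1) (-endp c) +
          2 * ladder β z f moment (-endp c)) else 0 := by
        rw [ENNReal.tsum_mul_left]
        refine mul_le_mul' le_rfl (ENNReal.tsum_le_tsum fun a => ?_)
        split_ifs
        · gcongr; exact ladder_moment_append_le f a c _
        · rfl
    _ = actWeight β z c * (4 * (twoPoint β z moment (v - endp c) *
          ladder β z f (fun _ => 1) (-endp c)) +
          4 * moment c * (twoPoint β z (fun _ => 1) (v - endp c) *
            ladder β z f (fun _ => 1) (-endp c)) +
          2 * (twoPoint β z (fun _ => 1) (v - endp c) * ladder β z f moment (-endp c))) := by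
        congr 1
        simp only [twoPoint, ← ENNReal.tsum_mul_right, ← ENNReal.tsum_mul_left, ← ENNReal.tsum_add]
        refine tsum_congr fun a => ?_
        split_ifs
        · ring
        · simp
    _ = _ := by ring

/-- Diagrammatic bound on the lace expansion. -/
lemma tsum_laceWeight_moment_le (h0 : 0 ≤ β) (h1 : β ≤ 1 / 2) {B D : ℝ≥0}
    (hB : ∑' x, twoPoint (d := d) β z (fun _ => 1) x ^ 2 ≤ B)
    (hD : ∀ x, twoPoint (d := d) β z moment x ≤ D) (hβ : 64 * (β * B) ≤ 1) :
    ∑' l : List (Fin d × Bool), (if 2 ≤ l.length then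
      ENNReal.ofReal |laceWeight β l| * ENNReal.ofReal z ^ l.length * moment l else 0) ≤
      ENNReal.ofReal (4 * β) * D := by
  have h1' : β ≤ 1 := by linarith
  have hlad : ∀ f, ladder (d := d) β z f moment 0 ≤ 2 * D := fun f => by
    refine ladder_bound (β := β.toNNReal) hB hD ?_ (ladder_zero β z _) (ladder_zero β z _)
      (ladder_one_succ_le h0 h1') (ladder_moment_succ_le h0 h1') f 0
    rw [← NNReal.coe_le_coe]
    push_cast
    rwa [Real.coe_toNNReal _ h0]
  have key : ∀ f, ∑' l : List (Fin d × Bool), (if 2 ≤ l.length ∧ l.length < f then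
      ENNReal.ofReal |laceWeight β l| * ENNReal.ofReal z ^ l.length * moment l else 0) ≤
      ENNReal.ofReal (2 * β) * ladder (d := d) β z f moment 0 := by
    intro f
    set F : List (Fin d × Bool) → List (Fin d × Bool) → ℝ≥0∞ := fun a b =>
      ENNReal.ofReal (2 * β) * if endp a = 0 then actWeight β z a *
        (ENNReal.ofReal (laceRem β f a b) * ENNReal.ofReal z ^ b.length * moment (a ++ b)) else 0
      with hF
    have hsum : ENNReal.ofReal (2 * β) * ladder (d := d) β z f moment 0 =
        ∑' l : List (Fin d × Bool), ∑ i ∈ range (l.length + 1), F (l.take i) (l.drop i) := by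
      rw [tsum_split F]
      simp only [hF, ENNReal.tsum_mul_left, ladder]
    rw [hsum]
    refine ENNReal.tsum_le_tsum fun l => ?_
    split_ifs with hl
    swap
    · exact zero_le
    have hn : ∀ t, 0 ≤ (if endp (l.take t) = 0 then β else 0) * walkWeight β (l.take t) *
        laceRem β f (l.take t) (l.drop t) := fun t =>
      mul_nonneg (mul_nonneg (by split_ifs <;> simp [h0]) (walkWeight_nonneg h1' _))
        (laceRem_nonneg h0 h1' _ _ _)
    calc _ ≤ ENNReal.ofReal (2 * ∑ t ∈ range (l.length + 1),
          (if endp (l.take t) = 0 then β else 0) * walkWeight β (l.take t) *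
          laceRem β f (l.take t) (l.drop t)) * ENNReal.ofReal z ^ l.length * moment l := by
          gcongr
          exact abs_laceWeight_le h0 h1 hl.1 hl.2
      _ = _ := by
          rw [mul_sum, ENNReal.ofReal_sum_of_nonneg fun t _ => mul_nonneg zero_le_two (hn t),
            sum_mul, sum_mul]
          refine sum_congr rfl fun t _ => ?_
          simp only [hF, List.take_append_drop]
          split_ifs with ht
          · rw [show 2 * (β * walkWeight β (l.take t) * laceRem β f (l.take t) (l.drop t)) =
              2 * β * (walkWeight β (l.take t) * laceRem β f (l.take t) (l.drop t)) by ring,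
              ENNReal.ofReal_mul (by linarith), ENNReal.ofReal_mul (walkWeight_nonneg h1' _)]
            have hz' : ENNReal.ofReal z ^ l.length =
              ENNReal.ofReal z ^ (l.take t).length * ENNReal.ofReal z ^ (l.drop t).length := by
              rw [← pow_add, ← List.length_append, List.take_append_drop]
            rw [hz']
            unfold actWeight
            ring
          · simp
  rw [ENNReal.tsum_eq_iSup_sum]
  refine iSup_le fun s => ?_
  obtain ⟨f, hf⟩ : ∃ f, ∀ l ∈ s, l.length < f := by
    refine ⟨s.sup List.length + 1, fun l hl => Nat.lt_succ_of_le (le_sup (f := List.length) hl)⟩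
  calc _ = ∑ l ∈ s, (if 2 ≤ l.length ∧ l.length < f then
      ENNReal.ofReal |laceWeight β l| * ENNReal.ofReal z ^ l.length * moment l else 0) :=
        sum_congr rfl fun l hl => by simp [hf l hl]
    _ ≤ _ := ENNReal.sum_le_tsum s
    _ ≤ ENNReal.ofReal (2 * β) * (2 * D) := (key f).trans (by gcongr; exact hlad f)
    _ = _ := by
        have : ENNReal.ofReal (4 * β) = 2 * ENNReal.ofReal (2 * β) := by
          rw [show 4 * β = 2 * (2 * β) by ring, ENNReal.ofReal_mul zero_le_two,
            ENNReal.ofReal_ofNat]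
        rw [this]; ring

/-- The time-weighted two-point function is dominated by the bubble. -/
lemma twoPoint_length_le (h0 : 0 ≤ β) (h1 : β ≤ 1) {B : ℝ≥0∞}
    (hB : ∑' x, twoPoint (d := d) β z (fun _ => 1) x ^ 2 ≤ B) (x : Fin d → ℤ) :
    twoPoint β z (fun l => (l.length : ℝ≥0∞)) x ≤ 2 * B := by
  set F : List (Fin d × Bool) → List (Fin d × Bool) → ℝ≥0∞ := fun a b =>
    if endp b = x - endp a then actWeight β z a * actWeight β z b else 0
  calc _ ≤ ∑' l : List (Fin d × Bool), ∑ i ∈ range (l.length + 1), F (l.take i) (l.drop i) := by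
        refine ENNReal.tsum_le_tsum fun l => ?_
        split_ifs with hl
        swap
        · exact zero_le
        calc actWeight β z l * l.length ≤ ∑ i ∈ range (l.length + 1), actWeight β z l := by
              rw [sum_const, card_range, nsmul_eq_mul, mul_comm]
              gcongr
              simp
          _ ≤ _ := by
              refine sum_le_sum fun i _ => ?_
              have : endp (l.drop i) = x - endp (l.take i) := by
                rw [eq_sub_iff_add_eq, add_comm, ← endp_append, List.take_append_drop, hl]
              simp only [F, if_pos this]
              have hle := actWeight_append_le (z := z) h0 h1 (l.take i) (l.drop i)
              rwa [List.take_append_drop] at hle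
    _ = ∑' a, actWeight β z a * 1 * twoPoint β z (fun _ => 1) (x - endp a) := by
        rw [tsum_split F]
        refine tsum_congr fun a => ?_
        simp only [F, twoPoint, ← ENNReal.tsum_mul_left]
        refine tsum_congr fun b => ?_
        split_ifs <;> simp
    _ = ∑' y, twoPoint β z (fun _ => 1) (0 + y) * twoPoint β z (fun _ => 1) (x + y) := by
        rw [tsum_actWeight_mul β z (fun _ => 1) (fun y => twoPoint β z (fun _ => 1) (x - y)),
          ← tsum_neg_arg]
        refine tsum_congr fun x => ?_
        rw [twoPoint_neg β z (fun _ => rfl), sub_neg_eq_add, zero_add]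
    _ ≤ 2 * B := tsum_correlation_le hB _ _

end WSAW

namespace WSAW
open Finset MeasureTheory
open scoped ENNReal NNReal Real

/-- Normalised Lebesgue measure on the interval `(-π, π]`. -/
noncomputable def circleMeasure : Measure ℝ :=
  (ENNReal.ofReal (2 * π))⁻¹ • volume.restrict (Set.Ioc (-π) π)

/-- Normalised Lebesgue measure on the Brillouin zone. -/
noncomputable def zoneMeasure (d : ℕ) : Measure (Fin d → ℝ) := Measure.pi fun _ => circleMeasure

instance : IsProbabilityMeasure circleMeasure := by
  constructor
  have h : π - -π = 2 * π := by ring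
  simp only [circleMeasure, Measure.smul_apply, Measure.restrict_apply MeasurableSet.univ,
    Set.univ_inter, Real.volume_Ioc, smul_eq_mul, h]
  exact ENNReal.inv_mul_cancel (by simp [Real.pi_pos]) ENNReal.ofReal_ne_top

instance (d : ℕ) : IsProbabilityMeasure (zoneMeasure d) := by
  unfold zoneMeasure; infer_instance

/-- The character `x ↦ exp (i k · x)` of `ℤ^d`. -/
noncomputable def character {d : ℕ} (k : Fin d → ℝ) (x : Fin d → ℤ) : ℂ :=
  Complex.exp (Complex.I * ((∑ j, k j * x j : ℝ) : ℂ))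

/-- The symbol `∑ j, (1 - cos (k j))` of the Laplacian. -/
noncomputable def symbol {d : ℕ} (k : Fin d → ℝ) : ℝ := ∑ j, (1 - Real.cos (k j))

section
variable {d : ℕ}

lemma norm_character (k : Fin d → ℝ) (x : Fin d → ℤ) : ‖character k x‖ = 1 := by
  rw [character, mul_comm, Complex.norm_exp_ofReal_mul_I]

lemma character_add (k : Fin d → ℝ) (x y : Fin d → ℤ) :
    character k (x + y) = character k x * character k y := by
  rw [character, character, character, ← Complex.exp_add]
  congr 1
  simp only [Pi.add_apply, Int.cast_add, mul_add, sum_add_distrib, Complex.ofReal_add]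

@[simp] lemma character_zero (k : Fin d → ℝ) : character k 0 = 1 := by simp [character]

lemma character_neg (k : Fin d → ℝ) (x : Fin d → ℤ) :
    character k (-x) = (starRingEnd ℂ) (character k x) := by
  rw [character, character, ← Complex.exp_conj]
  congr 1
  simp

lemma character_re (k : Fin d → ℝ) (x : Fin d → ℤ) :
    (character k x).re = Real.cos (∑ j, k j * x j) := by
  rw [character, mul_comm, Complex.exp_ofReal_mul_I_re]

lemma continuous_character (x : Fin d → ℤ) : Continuous fun k => character k x := by
  unfold character; fun_prop

lemma integral_circleMeasure (n : ℤ) :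
    ∫ t, Complex.exp (Complex.I * ((t * n : ℝ) : ℂ)) ∂circleMeasure = if n = 0 then 1 else 0 := by
  split_ifs with h
  · simp [h]
  · rw [circleMeasure, integral_smul_measure,
      ← intervalIntegral.integral_of_le (by linarith [Real.pi_pos])]
    have hc : Complex.I * n ≠ 0 := by simp [h]
    have : ∀ t : ℝ, Complex.I * ((t * n : ℝ) : ℂ) = Complex.I * n * t := fun t => by
      push_cast; ring
    simp only [this]
    rw [integral_exp_mul_complex hc]
    have : Complex.exp (Complex.I * n * (π : ℝ)) = Complex.exp (Complex.I * n * (-π : ℝ)) := by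
      rw [Complex.exp_eq_exp_iff_exists_int]
      exact ⟨n, by push_cast; ring⟩
    rw [this]; simp

lemma integral_character (x : Fin d → ℤ) :
    ∫ k, character k x ∂(zoneMeasure d) = if x = 0 then 1 else 0 := by
  have : ∀ k : Fin d → ℝ, character k x = ∏ j, Complex.exp (Complex.I * ((k j * x j : ℝ) : ℂ)) := by
    intro k
    rw [character, ← Complex.exp_sum, Complex.ofReal_sum, mul_sum]
  simp only [this]
  rw [zoneMeasure, integral_fintype_prod_eq_prod fun j t =>
    Complex.exp (Complex.I * ((t * x j : ℝ) : ℂ))]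
  simp only [integral_circleMeasure]
  rw [prod_ite_zero]
  simp [funext_iff]

lemma integral_tsum_character {ι : Type*} [Countable ι] {a : ι → ℂ} (ha : Summable fun i => ‖a i‖)
    (p : ι → Fin d → ℤ) :
    ∫ k, ∑' i, a i * character k (p i) ∂(zoneMeasure d) = ∑' i, if p i = 0 then a i else 0 := by
  rw [← integral_tsum_of_summable_integral_norm]
  · refine tsum_congr fun i => ?_
    rw [integral_const_mul, integral_character]
    split_ifs <;> simp
  · intro i
    refine Integrable.const_mul ?_ _
    refine (integrable_const (1 : ℝ)).mono' (continuous_character _).aestronglyMeasurable ?_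
    exact Filter.Eventually.of_forall fun k => (norm_character k _).le
  · simpa [norm_character] using ha

lemma symbol_nonneg (k : Fin d → ℝ) : 0 ≤ symbol k :=
  sum_nonneg fun j _ => by linarith [Real.cos_le_one (k j)]

lemma symbol_le (k : Fin d → ℝ) : symbol k ≤ 2 * d := by
  calc symbol k ≤ ∑ _j : Fin d, (2 : ℝ) := sum_le_sum fun j _ => by linarith [Real.neg_one_le_cos (k j)]
    _ = 2 * d := by simp [mul_comm]

lemma norm_exp_sub_one_sq (t : ℝ) :
    ‖Complex.exp (Complex.I * t) - 1‖ ^ 2 = 2 * (1 - Real.cos t) := by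
  rw [mul_comm, Complex.sq_norm, Complex.normSq_apply]
  simp only [Complex.sub_re, Complex.sub_im, Complex.exp_ofReal_mul_I_re,
    Complex.exp_ofReal_mul_I_im, Complex.one_re, Complex.one_im]
  nlinarith [Real.sin_sq_add_cos_sq t]

lemma norm_exp_natMul_sub_one_le (t : ℝ) (n : ℕ) :
    ‖Complex.exp (Complex.I * ((t * n : ℝ) : ℂ)) - 1‖ ≤ n * ‖Complex.exp (Complex.I * t) - 1‖ := by
  induction n with
  | zero => simp
  | succ n ih =>
    have : Complex.exp (Complex.I * ((t * (n + 1 : ℕ) : ℝ) : ℂ)) - 1 =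
        Complex.exp (Complex.I * ((t * n : ℝ) : ℂ)) * (Complex.exp (Complex.I * t) - 1) +
        (Complex.exp (Complex.I * ((t * n : ℝ) : ℂ)) - 1) := by
      rw [show Complex.I * ((t * (n + 1 : ℕ) : ℝ) : ℂ) =
        Complex.I * ((t * n : ℝ) : ℂ) + Complex.I * t by push_cast; ring, Complex.exp_add]
      ring
    rw [this]
    refine (norm_add_le _ _).trans ?_
    rw [norm_mul, mul_comm Complex.I ((t * n : ℝ) : ℂ), Complex.norm_exp_ofReal_mul_I, one_mul,
      mul_comm ((t * n : ℝ) : ℂ)]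
    push_cast at ih ⊢
    linarith

lemma norm_character_sub_one_le (k : Fin d → ℝ) (x : Fin d → ℤ) :
    ‖character k x - 1‖ ≤ ∑ j, |(x j : ℝ)| * ‖Complex.exp (Complex.I * (k j : ℂ)) - 1‖ := by
  have hprod : ∀ s : Finset (Fin d), ‖∏ j ∈ s, Complex.exp (Complex.I * ((k j * x j : ℝ) : ℂ)) - 1‖
      ≤ ∑ j ∈ s, ‖Complex.exp (Complex.I * ((k j * x j : ℝ) : ℂ)) - 1‖ := by
    intro s
    induction s using Finset.induction_on with
    | empty => simp
    | insert i s hi ih =>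
      rw [prod_insert hi, sum_insert hi]
      set a := Complex.exp (Complex.I * ((k i * x i : ℝ) : ℂ)) with ha
      set b := ∏ j ∈ s, Complex.exp (Complex.I * ((k j * x j : ℝ) : ℂ))
      have hna : ‖a‖ = 1 := by rw [ha, mul_comm, Complex.norm_exp_ofReal_mul_I]
      calc ‖a * b - 1‖ = ‖(a - 1) + a * (b - 1)‖ := by congr 1; ring
        _ ≤ ‖a - 1‖ + ‖a‖ * ‖b - 1‖ := (norm_add_le _ _).trans (by rw [norm_mul])
        _ ≤ _ := by rw [hna, one_mul]; gcongr
  have hc : character k x = ∏ j, Complex.exp (Complex.I * ((k j * x j : ℝ) : ℂ)) := by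
    rw [character, ← Complex.exp_sum, Complex.ofReal_sum, mul_sum]
  rw [hc]
  refine (hprod univ).trans (sum_le_sum fun j _ => ?_)
  rcases Int.natAbs_eq (x j) with h | h
  · have h' : (x j : ℝ) = ((x j).natAbs : ℝ) :=
      (congrArg (Int.cast : ℤ → ℝ) h).trans (Int.cast_natCast _)
    rw [h', Nat.abs_cast]
    exact norm_exp_natMul_sub_one_le _ _
  · have h' : (x j : ℝ) = -((x j).natAbs : ℝ) :=
      (congrArg (Int.cast : ℤ → ℝ) h).trans (by rw [Int.cast_neg, Int.cast_natCast])
    rw [h', abs_neg, Nat.abs_cast]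
    refine le_trans (le_of_eq ?_) (norm_exp_natMul_sub_one_le (k j) (x j).natAbs)
    rw [← Complex.norm_conj, map_sub, ← Complex.exp_conj]
    simp

lemma norm_character_sub_one_sq_le (k : Fin d → ℝ) (x : Fin d → ℤ) :
    ‖character k x - 1‖ ^ 2 ≤ 2 * (∑ j, (x j : ℝ) ^ 2) * symbol k := by
  calc _ ≤ (∑ j, |(x j : ℝ)| * ‖Complex.exp (Complex.I * (k j : ℂ)) - 1‖) ^ 2 := by
        gcongr; exact norm_character_sub_one_le k x
    _ ≤ (∑ j, |(x j : ℝ)| ^ 2) * ∑ j, ‖Complex.exp (Complex.I * (k j : ℂ)) - 1‖ ^ 2 :=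
        sum_mul_sq_le_sq_mul_sq _ _ _
    _ = _ := by
        simp only [norm_exp_sub_one_sq, sq_abs, ← mul_sum]
        rw [symbol]; ring

lemma one_sub_character_re_le (k : Fin d → ℝ) (x : Fin d → ℤ) :
    1 - (character k x).re ≤ (∑ j, (x j : ℝ) ^ 2) * symbol k := by
  have h := norm_character_sub_one_sq_le k x
  rw [character, norm_exp_sub_one_sq, ← character_re] at h
  linarith

lemma one_sub_character_re_nonneg (k : Fin d → ℝ) (x : Fin d → ℤ) :
    0 ≤ 1 - (character k x).re := by
  rw [character_re]; linarith [Real.cos_le_one (∑ j, k j * x j)]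

lemma lintegral_one_sub_cos_rpow_lt_top {r : ℝ} (h0 : r ≤ 0) (hr : -1 < 2 * r) :
    ∫⁻ t, ENNReal.ofReal (1 - Real.cos t) ^ r ∂circleMeasure < ∞ := by
  have hI : IntegrableOn (fun t : ℝ => ‖(t : ℂ) ^ ((2 * r : ℝ) : ℂ)‖) (Set.Ioc (-π) π) := by
    rw [← intervalIntegrable_iff_integrableOn_Ioc_of_le (by linarith [Real.pi_pos])]
    exact (intervalIntegral.intervalIntegrable_cpow' (by simpa using hr)).norm
  have hpi : 0 < 2 / π ^ 2 := by positivity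
  have hbound : ∫⁻ t in Set.Ioc (-π) π, ENNReal.ofReal (1 - Real.cos t) ^ r ≤
      ∫⁻ t in Set.Ioc (-π) π, ENNReal.ofReal ((2 / π ^ 2) ^ r * ‖(t : ℂ) ^ ((2 * r : ℝ) : ℂ)‖) := by
    refine lintegral_mono_ae ?_
    have hne : ∀ᵐ t ∂(volume.restrict (Set.Ioc (-π) π)), t ≠ (0 : ℝ) :=
      ae_restrict_of_ae (by simp [ae_iff])
    filter_upwards [hne, ae_restrict_mem measurableSet_Ioc] with t ht hm
    have hle := Real.cos_le_one_sub_mul_cos_sq (abs_le.2 ⟨hm.1.le, hm.2⟩)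
    have hpos : 0 < 2 / π ^ 2 * t ^ 2 := by positivity
    have hpos' : 0 < 1 - Real.cos t := by linarith
    rw [ENNReal.ofReal_rpow_of_pos hpos', Complex.norm_cpow_real, Complex.norm_real]
    refine ENNReal.ofReal_le_ofReal ?_
    calc _ ≤ (2 / π ^ 2 * t ^ 2) ^ r := Real.rpow_le_rpow_of_nonpos hpos (by linarith) h0
      _ = _ := by
        rw [Real.mul_rpow hpi.le (sq_nonneg t), Real.rpow_mul (norm_nonneg _), Real.norm_eq_abs,
          Real.rpow_two, sq_abs]
  rw [circleMeasure, lintegral_smul_measure]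
  refine ENNReal.mul_lt_top (by simp [Real.pi_pos]) (hbound.trans_lt ?_)
  exact (hI.const_mul _).lintegral_lt_top

lemma lintegral_symbol_lt_top (hd : 4 < d) :
    ∫⁻ k, ENNReal.ofReal (symbol k) ^ (-2 : ℝ) ∂(zoneMeasure d) < ∞ := by
  set r : ℝ := -2 / d with hr
  have hd' : (4 : ℝ) < d := by exact_mod_cast hd
  have hr0 : r ≤ 0 := div_nonpos_of_nonpos_of_nonneg (by norm_num) (by linarith)
  have hr1 : -1 < 2 * r := by
    rw [hr, ← mul_div_assoc, lt_div_iff₀ (by linarith)]; linarith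
  have hmeas : Measurable fun t : ℝ => ENNReal.ofReal (1 - Real.cos t) ^ r := by fun_prop
  calc _ ≤ ∫⁻ k : Fin d → ℝ, ∏ j : Fin d, ENNReal.ofReal (1 - Real.cos (k j)) ^ r
        ∂(zoneMeasure d) := by
        refine lintegral_mono fun k => ?_
        have : ENNReal.ofReal (symbol k) ^ (-2 : ℝ) =
            ∏ _j : Fin d, ENNReal.ofReal (symbol k) ^ r := by
          rw [prod_const, card_univ, Fintype.card_fin, ← ENNReal.rpow_natCast, ← ENNReal.rpow_mul,
            hr, div_mul_cancel₀ _ (by linarith)]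
        rw [this]
        refine prod_le_prod' fun j _ => ?_
        rw [← neg_neg r, ENNReal.rpow_neg, ENNReal.rpow_neg _ (-r), ENNReal.inv_le_inv]
        refine ENNReal.rpow_le_rpow (ENNReal.ofReal_le_ofReal ?_) (by linarith)
        exact single_le_sum (f := fun j => 1 - Real.cos (k j))
          (fun i _ => by linarith [Real.cos_le_one (k i)]) (mem_univ j)
    _ = ∏ _j : Fin d, ∫⁻ t, ENNReal.ofReal (1 - Real.cos t) ^ r ∂circleMeasure := by
        have hind := ProbabilityTheory.iIndepFun_pi (μ := fun _ : Fin d => circleMeasure)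
          (X := fun _ t => ENNReal.ofReal (1 - Real.cos t) ^ r) fun _ => hmeas.aemeasurable
        rw [zoneMeasure, ProbabilityTheory.lintegral_prod_eq_prod_lintegral_of_indepFun univ _ hind
          fun j => hmeas.comp (measurable_pi_apply j)]
        refine prod_congr rfl fun j _ => ?_
        exact (measurePreserving_eval (fun _ : Fin d => circleMeasure) j).lintegral_comp hmeas
    _ < ∞ := ENNReal.prod_lt_top fun j _ => lintegral_one_sub_cos_rpow_lt_top hr0 hr1

end
end WSAW

namespace WSAW
open Finset MeasureTheory
open scoped ENNReal NNReal Real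

variable {d : ℕ} {β z : ℝ}

/-- The weight of a walk with activity `z`, as a real number. -/
noncomputable def walkAct (β z : ℝ) (l : List (Fin d × Bool)) : ℝ := walkWeight β l * z ^ l.length

/-- The lace weight of a walk with activity `z`. -/
noncomputable def laceAct (β z : ℝ) (l : List (Fin d × Bool)) : ℝ := laceWeight β l * z ^ l.length

/-- The squared Euclidean displacement. -/
noncomputable def sqDisp (l : List (Fin d × Bool)) : ℝ := ∑ j, (endp l j : ℝ) ^ 2

lemma sqDisp_nonneg (l : List (Fin d × Bool)) : 0 ≤ sqDisp l := sum_nonneg fun _ _ => sq_nonneg _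

lemma momentWeight_eq (l : List (Fin d × Bool)) :
    (momentWeight l : ℝ) = l.length + sqDisp l := by
  have : ∀ n : ℤ, ((n.natAbs : ℕ) : ℝ) ^ 2 = (n : ℝ) ^ 2 := fun n => by
    rw [← Int.cast_natCast, Int.natCast_natAbs, Int.cast_abs, sq_abs]
  simp [momentWeight, sqDisp]

lemma sq_endp_le (l : List (Fin d × Bool)) (i : Fin d) : (endp l i : ℝ) ^ 2 ≤ sqDisp l :=
  single_le_sum (f := fun j => (endp l j : ℝ) ^ 2) (fun _ _ => sq_nonneg _) (mem_univ i)

lemma sqDisp_le_moment (l : List (Fin d × Bool)) : sqDisp l ≤ momentWeight l := by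
  rw [momentWeight_eq]; linarith [(Nat.cast_nonneg l.length : (0 : ℝ) ≤ _)]

/-- The lattice Fourier transform of a weight on walks. -/
noncomputable def walkFourier (a φ : List (Fin d × Bool) → ℝ) (k : Fin d → ℝ) : ℂ :=
  ∑' l, ((a l * φ l : ℝ) : ℂ) * character k (endp l)

lemma walkAct_nonneg (h1 : β ≤ 1) (hz : 0 ≤ z) (l : List (Fin d × Bool)) : 0 ≤ walkAct β z l :=
  mul_nonneg (walkWeight_nonneg h1 l) (pow_nonneg hz _)

/-- Convolution identity of the lace expansion. -/
lemma tsum_walkAct {φ : List (Fin d × Bool) → ℂ}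
    (h : Summable fun p : List (Fin d × Bool) × List (Fin d × Bool) =>
      (laceAct β z p.1 * walkAct β z p.2 : ℂ) * φ (p.1 ++ p.2)) :
    ∑' l, (walkAct β z l : ℂ) * φ l = φ [] +
      ∑' p : List (Fin d × Bool) × List (Fin d × Bool),
        (laceAct β z p.1 * walkAct β z p.2 : ℂ) * φ (p.1 ++ p.2) := by
  have hs := splitEquiv.summable_iff.2 h
  have heq : ∀ l : List (Fin d × Bool), (walkAct β z l : ℂ) * φ l = (if l = [] then φ [] else 0) +
      ∑' i : Fin (l.length + 1), ((fun p : List (Fin d × Bool) × List (Fin d × Bool) =>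
      (laceAct β z p.1 * walkAct β z p.2 : ℂ) * φ (p.1 ++ p.2)) ∘ splitEquiv) ⟨l, i⟩ := by
    intro l
    rw [walkAct, walkWeight_eq_sum, tsum_fintype, Finset.sum_range]
    push_cast
    rw [add_mul, add_mul, sum_mul, sum_mul]
    congr 1
    · split_ifs with hl
      · subst hl; simp
      · simp
    · refine sum_congr rfl fun i _ => ?_
      have : splitEquiv (⟨l, i⟩ : Σ l : List (Fin d × Bool), Fin (l.length + 1)) =
        (l.take i, l.drop i) := rfl
      simp only [Function.comp, this, List.take_append_drop, laceAct, walkAct]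
      have hz : (z : ℂ) ^ l.length = (z : ℂ) ^ (l.take i).length * (z : ℂ) ^ (l.drop i).length := by
        rw [← pow_add, ← List.length_append, List.take_append_drop]
      rw [hz]; push_cast; ring
  rw [tsum_congr heq, Summable.tsum_add (hasSum_ite_eq _ _).summable hs.sigma, tsum_ite_eq,
    ← hs.tsum_sigma, ← splitEquiv.tsum_eq]
  rfl

lemma summable_norm_walkFourier {a φ : List (Fin d × Bool) → ℝ}
    (h : Summable fun l => |a l| * (1 + momentWeight l)) {C : ℝ}
    (hφ : ∀ l, |φ l| ≤ C * (1 + momentWeight l)) (k : Fin d → ℝ) :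
    Summable fun l => ‖((a l * φ l : ℝ) : ℂ) * character k (endp l)‖ := by
  refine Summable.of_nonneg_of_le (fun l => norm_nonneg _) (fun l => ?_) (h.mul_left C)
  rw [norm_mul, norm_character, mul_one, Complex.norm_real, Real.norm_eq_abs, abs_mul]
  calc _ ≤ |a l| * (C * (1 + momentWeight l)) := by gcongr; exact hφ l
    _ = _ := by ring

lemma abs_one_le (l : List (Fin d × Bool)) : |(1 : ℝ)| ≤ 1 * (1 + momentWeight l) := by
  rw [abs_one, one_mul]; linarith [(Nat.cast_nonneg (momentWeight l) : (0 : ℝ) ≤ _)]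

lemma abs_endp_sq_le (i : Fin d) (l : List (Fin d × Bool)) :
    |(endp l i : ℝ) ^ 2| ≤ 1 * (1 + momentWeight l) := by
  rw [abs_of_nonneg (sq_nonneg _)]
  linarith [sq_endp_le l i, sqDisp_le_moment l]

lemma abs_endp_le (i : Fin d) (l : List (Fin d × Bool)) :
    |(endp l i : ℝ)| ≤ 1 * (1 + momentWeight l) := by
  have := abs_endp_sq_le i l
  rw [abs_of_nonneg (sq_nonneg _), ← sq_abs] at this
  nlinarith [sq_nonneg (|(endp l i : ℝ)| - 1), abs_nonneg (endp l i : ℝ)]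

section identities
variable (hK : Summable fun l : List (Fin d × Bool) => |walkAct β z l| * (1 + momentWeight l))
  (hJ : Summable fun l : List (Fin d × Bool) => |laceAct β z l| * (1 + momentWeight l))
include hK hJ

lemma walkFourier_one (k : Fin d → ℝ) :
    walkFourier (walkAct β z) (fun _ => 1) k = 1 +
      walkFourier (laceAct β z) (fun _ => 1) k * walkFourier (walkAct β z) (fun _ => 1) k := by
  have sK := summable_norm_walkFourier hK abs_one_le k
  have sJ := summable_norm_walkFourier hJ abs_one_le k
  have hp := summable_mul_of_summable_norm sJ sK
  have e : ∀ p : List (Fin d × Bool) × List (Fin d × Bool),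
      ((laceAct β z p.1 * 1 : ℝ) : ℂ) * character k (endp p.1) *
      (((walkAct β z p.2 * 1 : ℝ) : ℂ) * character k (endp p.2)) =
      (laceAct β z p.1 * walkAct β z p.2 : ℂ) * character k (endp (p.1 ++ p.2)) := fun p => by
    rw [endp_append, character_add]; push_cast; ring
  simp only [walkFourier]
  rw [tsum_mul_tsum_of_summable_norm sJ sK]
  simp only [e] at hp ⊢
  have := tsum_walkAct (φ := fun l => character k (endp l)) hp
  simpa [mul_one] using this

lemma walkFourier_endp (k : Fin d → ℝ) (i : Fin d) :
    walkFourier (walkAct β z) (fun l => (endp l i : ℝ)) k =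
      walkFourier (laceAct β z) (fun l => (endp l i : ℝ)) k *
        walkFourier (walkAct β z) (fun _ => 1) k +
      walkFourier (laceAct β z) (fun _ => 1) k *
        walkFourier (walkAct β z) (fun l => (endp l i : ℝ)) k := by
  have sK := summable_norm_walkFourier hK abs_one_le k
  have sJ := summable_norm_walkFourier hJ abs_one_le k
  have sK1 := summable_norm_walkFourier hK (abs_endp_le i) k
  have sJ1 := summable_norm_walkFourier hJ (abs_endp_le i) k
  have hp1 := summable_mul_of_summable_norm sJ1 sK
  have hp2 := summable_mul_of_summable_norm sJ sK1
  have hp := hp1.add hp2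
  have e : ∀ p : List (Fin d × Bool) × List (Fin d × Bool),
      ((laceAct β z p.1 * (endp p.1 i : ℝ) : ℝ) : ℂ) * character k (endp p.1) *
      (((walkAct β z p.2 * 1 : ℝ) : ℂ) * character k (endp p.2)) +
      ((laceAct β z p.1 * 1 : ℝ) : ℂ) * character k (endp p.1) *
      (((walkAct β z p.2 * (endp p.2 i : ℝ) : ℝ) : ℂ) * character k (endp p.2)) =
      (laceAct β z p.1 * walkAct β z p.2 : ℂ) *
        ((endp (p.1 ++ p.2) i : ℂ) * character k (endp (p.1 ++ p.2))) := fun p => by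
    rw [endp_append, character_add]; push_cast [Pi.add_apply]; ring
  simp only [walkFourier]
  rw [tsum_mul_tsum_of_summable_norm sJ1 sK, tsum_mul_tsum_of_summable_norm sJ sK1,
    ← hp1.tsum_add hp2]
  simp only [e] at hp ⊢
  have := tsum_walkAct (φ := fun l => (endp l i : ℂ) * character k (endp l)) hp
  simpa [← mul_assoc] using this

lemma walkFourier_endp_sq (k : Fin d → ℝ) (i : Fin d) :
    walkFourier (walkAct β z) (fun l => (endp l i : ℝ) ^ 2) k =
      walkFourier (laceAct β z) (fun l => (endp l i : ℝ) ^ 2) k *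
        walkFourier (walkAct β z) (fun _ => 1) k +
      2 * (walkFourier (laceAct β z) (fun l => (endp l i : ℝ)) k *
        walkFourier (walkAct β z) (fun l => (endp l i : ℝ)) k) +
      walkFourier (laceAct β z) (fun _ => 1) k *
        walkFourier (walkAct β z) (fun l => (endp l i : ℝ) ^ 2) k := by
  have sK := summable_norm_walkFourier hK abs_one_le k
  have sJ := summable_norm_walkFourier hJ abs_one_le k
  have sK1 := summable_norm_walkFourier hK (abs_endp_le i) k
  have sJ1 := summable_norm_walkFourier hJ (abs_endp_le i) k
  have sK2 := summable_norm_walkFourier hK (abs_endp_sq_le i) k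
  have sJ2 := summable_norm_walkFourier hJ (abs_endp_sq_le i) k
  have hp1 := summable_mul_of_summable_norm sJ2 sK
  have hp2 := (summable_mul_of_summable_norm sJ1 sK1).mul_left 2
  have hp3 := summable_mul_of_summable_norm sJ sK2
  have hp := (hp1.add hp2).add hp3
  have e : ∀ p : List (Fin d × Bool) × List (Fin d × Bool),
      ((laceAct β z p.1 * (endp p.1 i : ℝ) ^ 2 : ℝ) : ℂ) * character k (endp p.1) *
      (((walkAct β z p.2 * 1 : ℝ) : ℂ) * character k (endp p.2)) +
      2 * (((laceAct β z p.1 * (endp p.1 i : ℝ) : ℝ) : ℂ) * character k (endp p.1) *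
      (((walkAct β z p.2 * (endp p.2 i : ℝ) : ℝ) : ℂ) * character k (endp p.2))) +
      ((laceAct β z p.1 * 1 : ℝ) : ℂ) * character k (endp p.1) *
      (((walkAct β z p.2 * (endp p.2 i : ℝ) ^ 2 : ℝ) : ℂ) * character k (endp p.2)) =
      (laceAct β z p.1 * walkAct β z p.2 : ℂ) *
        ((endp (p.1 ++ p.2) i : ℂ) ^ 2 * character k (endp (p.1 ++ p.2))) := fun p => by
    rw [endp_append, character_add]; push_cast [Pi.add_apply]; ring
  simp only [walkFourier]
  rw [tsum_mul_tsum_of_summable_norm sJ2 sK, tsum_mul_tsum_of_summable_norm sJ1 sK1,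
    tsum_mul_tsum_of_summable_norm sJ sK2, ← tsum_mul_left,
    ← hp1.tsum_add hp2, ← (hp1.add hp2).tsum_add hp3]
  simp only [e] at hp ⊢
  have := tsum_walkAct (φ := fun l => (endp l i : ℂ) ^ 2 * character k (endp l)) hp
  simpa [← mul_assoc] using this

end identities

/-- A sum over one-step walks. -/
lemma hasSum_length_one {M : Type*} [AddCommMonoid M] [TopologicalSpace M]
    (φ : List (Fin d × Bool) → M) :
    HasSum (fun l : List (Fin d × Bool) => if l.length = 1 then φ l else 0) (∑ e, φ [e]) := by
  have hinj : Function.Injective fun e : Fin d × Bool => [e] := fun a b h => by simpa using h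
  have h := hasSum_fintype fun e : Fin d × Bool =>
    (fun l : List (Fin d × Bool) => if l.length = 1 then φ l else 0) [e]
  have := (hinj.hasSum_iff (f := fun l : List (Fin d × Bool) =>
    if l.length = 1 then φ l else 0) fun l hl => if_neg fun h1 => hl ?_).1 h
  · simpa using this
  · obtain ⟨e, rfl⟩ := List.length_eq_one_iff.1 h1
    exact ⟨e, rfl⟩

end WSAW

namespace WSAW
open Finset MeasureTheory
open scoped ENNReal NNReal Real

variable {d : ℕ} {β z ε : ℝ}

lemma endp_singleton (e : Fin d × Bool) : endp [e] = wsawStep d e := by simp [endp]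

lemma sqDisp_singleton (e : Fin d × Bool) : sqDisp [e] = 1 := by
  rcases e with ⟨j, b⟩
  rw [sqDisp, endp_singleton, sum_eq_single j]
  · cases b <;> simp [wsawStep]
  · intro i _ hi; simp [wsawStep, hi]
  · simp

lemma character_re_singleton (k : Fin d → ℝ) (e : Fin d × Bool) :
    (character k (endp [e])).re = Real.cos (k e.1) := by
  rcases e with ⟨j, b⟩
  rw [character_re, endp_singleton, sum_eq_single j]
  · cases b <;> simp [wsawStep]
  · intro i _ hi; simp [wsawStep, hi]
  · simp

lemma one_le_moment {l : List (Fin d × Bool)} (hl : 2 ≤ l.length) : (1 : ℝ) ≤ momentWeight l := by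
  have : 1 ≤ momentWeight l := by unfold momentWeight; omega
  exact_mod_cast this

/-- Sums against a lace weight are dominated by the one-step walks. -/
lemma abs_tsum_sub_le {a : List (Fin d × Bool) → ℝ} (ha0 : a [] = 0)
    (ha1 : ∀ l, l.length = 1 → a l = z) (ha : ∀ l, |a l| ≤ |laceAct β z l|)
    (hJ : Summable fun l : List (Fin d × Bool) => |laceAct β z l| * (1 + momentWeight l))
    (hε : ∑' l : List (Fin d × Bool),
      (if 2 ≤ l.length then |laceAct β z l| * momentWeight l else 0) ≤ ε)
    {φ : List (Fin d × Bool) → ℝ} {C : ℝ} (hC : 0 ≤ C)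
    (hφ : ∀ l, 2 ≤ l.length → |φ l| ≤ C * momentWeight l) :
    |∑' l, a l * φ l - z * ∑ e, φ [e]| ≤ C * ε := by
  have hnn : ∀ l : List (Fin d × Bool), (0 : ℝ) ≤ momentWeight l := fun l => Nat.cast_nonneg _
  have hs : Summable fun l : List (Fin d × Bool) =>
      (if 2 ≤ l.length then |laceAct β z l| * momentWeight l else 0) := by
    refine Summable.of_nonneg_of_le (fun l => ?_) (fun l => ?_) hJ
    · split_ifs
      · exact mul_nonneg (abs_nonneg _) (hnn l)
      · rfl
    · split_ifs
      · gcongr; linarith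
      · exact mul_nonneg (abs_nonneg _) (by linarith [hnn l])
  have hb : ∀ l, ‖(if 2 ≤ l.length then a l * φ l else 0)‖ ≤
      C * (if 2 ≤ l.length then |laceAct β z l| * momentWeight l else 0) := by
    intro l
    split_ifs with hl
    · rw [Real.norm_eq_abs, abs_mul]
      calc _ ≤ |laceAct β z l| * (C * momentWeight l) :=
            mul_le_mul (ha l) (hφ l hl) (abs_nonneg _) (abs_nonneg _)
        _ = _ := by ring
    · simp
  have hr : Summable fun l => (if 2 ≤ l.length then a l * φ l else 0) :=
    Summable.of_norm_bounded (hs.mul_left C) hb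
  have h1 := hasSum_length_one fun l : List (Fin d × Bool) => z * φ l
  have hsplit : ∀ l, a l * φ l = (if l.length = 1 then z * φ l else 0) +
      (if 2 ≤ l.length then a l * φ l else 0) := by
    intro l
    rcases Nat.lt_trichotomy l.length 1 with h | h | h
    · have : l = [] := List.length_eq_zero_iff.1 (by omega)
      subst this; simp [ha0]
    · simp [h, ha1 l h]
    · simp [show l.length ≠ 1 by omega, show 2 ≤ l.length by omega]
  rw [tsum_congr hsplit, h1.summable.tsum_add hr, h1.tsum_eq, ← mul_sum, add_sub_cancel_left]
  calc _ ≤ ∑' l, C * (if 2 ≤ l.length then |laceAct β z l| * momentWeight l else 0) :=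
        tsum_of_norm_bounded (hs.mul_left C).hasSum hb
    _ ≤ C * ε := by rw [tsum_mul_left]; gcongr

lemma laceAct_nil : laceAct β z ([] : List (Fin d × Bool)) = 0 := by simp [laceAct]

lemma laceAct_of_length_one {l : List (Fin d × Bool)} (hl : l.length = 1) : laceAct β z l = z := by
  simp [laceAct, laceWeight_of_length_one hl, hl]

lemma laceAct_flipSteps (l : List (Fin d × Bool)) :
    laceAct β z (flipSteps l) = laceAct β z l := by
  simp [laceAct, laceWeight_flipSteps, flipSteps_length]

/-- The hypotheses under which the lace expansion is a small perturbation of the simple walk. -/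
structure Perturbative (d : ℕ) (β z ε : ℝ) : Prop where
  dim : 0 < d
  h1 : β ≤ 1
  hz : 0 ≤ z
  hK : Summable fun l : List (Fin d × Bool) => |walkAct β z l| * (1 + momentWeight l)
  hJ : Summable fun l : List (Fin d × Bool) => |laceAct β z l| * (1 + momentWeight l)
  hε : ∑' l : List (Fin d × Bool),
      (if 2 ≤ l.length then |laceAct β z l| * momentWeight l else 0) ≤ ε
  small : 16 * (d * ε) ≤ 1

namespace Perturbative
variable (H : Perturbative d β z ε)
include H

lemma eps_nonneg : 0 ≤ ε := le_trans (tsum_nonneg fun l => by positivity) H.hε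

lemma summable_walkAct : Summable (walkAct (d := d) β z) := by
  refine Summable.of_norm_bounded H.hK fun l => ?_
  rw [Real.norm_eq_abs]
  exact le_mul_of_one_le_right (abs_nonneg _) (by simp)

lemma summable_laceAct : Summable (laceAct (d := d) β z) := by
  refine Summable.of_norm_bounded H.hJ fun l => ?_
  rw [Real.norm_eq_abs]
  exact le_mul_of_one_le_right (abs_nonneg _) (by simp)

lemma abs_tsum_laceAct_sub_le : |∑' l, laceAct (d := d) β z l - 2 * d * z| ≤ ε := by
  have := abs_tsum_sub_le (d := d) laceAct_nil (fun _ => laceAct_of_length_one) (fun _ => le_rfl)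
    H.hJ H.hε zero_le_one (φ := fun _ => 1) fun l hl => by simpa using one_le_moment hl
  simp only [mul_one, one_mul, sum_const, card_univ, Fintype.card_prod, Fintype.card_fin,
    Fintype.card_bool, nsmul_eq_mul, Nat.cast_mul, Nat.cast_ofNat] at this
  convert this using 3
  ring

/-- The inverse susceptibility identity at zero momentum. -/
lemma one_sub_mul_tsum : (1 - ∑' l, laceAct (d := d) β z l) * ∑' l, walkAct (d := d) β z l = 1 := by
  have := walkFourier_one H.hK H.hJ (fun _ => 0)
  simp only [walkFourier, mul_one, character, zero_mul, sum_const_zero, Complex.ofReal_zero,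
    mul_zero, Complex.exp_zero, ← Complex.ofReal_tsum] at this
  have h : ∑' l, walkAct (d := d) β z l = 1 +
    (∑' l, laceAct (d := d) β z l) * ∑' l, walkAct (d := d) β z l := by exact_mod_cast this
  linarith

lemma one_sub_tsum_nonneg : 0 ≤ 1 - ∑' l, laceAct (d := d) β z l := by
  by_contra! h
  have h2 : 0 ≤ ∑' l, walkAct (d := d) β z l := tsum_nonneg fun l => walkAct_nonneg H.h1 H.hz l
  have := H.one_sub_mul_tsum
  nlinarith

lemma two_mul_le : 2 * d * z ≤ 1 + ε := by
  have h := H.abs_tsum_laceAct_sub_le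
  have := H.one_sub_tsum_nonneg
  rw [abs_le] at h
  linarith

lemma tsum_abs_mul_sqDisp_le : ∑' l, |laceAct (d := d) β z l| * sqDisp l ≤ 2 := by
  have := abs_tsum_sub_le (d := d) (a := fun l => |laceAct β z l|) (by simp [laceAct_nil])
    (fun l hl => by rw [laceAct_of_length_one hl, abs_of_nonneg H.hz])
    (fun _ => (abs_abs _).le) H.hJ H.hε zero_le_one (φ := sqDisp) fun l _ => by
      rw [abs_of_nonneg (sqDisp_nonneg l), one_mul]; exact sqDisp_le_moment l
  simp only [sqDisp_singleton, one_mul, sum_const, card_univ, Fintype.card_prod, Fintype.card_fin,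
    Fintype.card_bool, nsmul_eq_mul, Nat.cast_mul, Nat.cast_ofNat, mul_one] at this
  have h2 := H.two_mul_le
  have h3 := H.small
  have hd : (1 : ℝ) ≤ d := by exact_mod_cast H.dim
  have h4 := H.eps_nonneg
  rw [abs_le] at this
  nlinarith

lemma summable_abs_mul_sqDisp : Summable fun l => |laceAct (d := d) β z l| * sqDisp l :=
  Summable.of_nonneg_of_le (fun l => mul_nonneg (abs_nonneg _) (sqDisp_nonneg l))
    (fun l => by gcongr; linarith [sqDisp_le_moment l]) H.hJ

/-- The infrared bound. -/
lemma symbol_le_norm (k : Fin d → ℝ) :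
    symbol k ≤ 8 * d * ‖1 - walkFourier (laceAct β z) (fun _ => 1) k‖ := by
  have hd : (1 : ℝ) ≤ d := by exact_mod_cast H.dim
  have hA := symbol_nonneg k
  have hA2 := symbol_le k
  have hre : (1 - walkFourier (laceAct β z) (fun _ => 1) k).re =
      (1 - ∑' l, laceAct (d := d) β z l) +
      ∑' l, laceAct (d := d) β z l * (1 - (character k (endp l)).re) := by
    have s0 := summable_norm_walkFourier H.hJ abs_one_le k
    have e : ∀ l : List (Fin d × Bool), (((laceAct β z l * 1 : ℝ) : ℂ) * character k (endp l)).re =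
      laceAct β z l * (character k (endp l)).re := fun l => by
        rw [Complex.re_ofReal_mul, mul_one]
    have s1 : Summable fun l : List (Fin d × Bool) => laceAct β z l * (character k (endp l)).re := by
      have := Complex.reCLM.summable s0.of_norm
      simpa [e] using this
    rw [Complex.sub_re, Complex.one_re, walkFourier, Complex.re_tsum s0.of_norm,
      tsum_congr e]
    simp only [mul_sub, mul_one]
    rw [H.summable_laceAct.tsum_sub s1]
    ring
  have h1 := abs_tsum_sub_le (d := d) laceAct_nil (fun _ => laceAct_of_length_one) (fun _ => le_rfl)
    H.hJ H.hε hA (φ := fun l => 1 - (character k (endp l)).re) fun l hl => by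
      rw [abs_of_nonneg (one_sub_character_re_nonneg _ _), mul_comm]
      refine (one_sub_character_re_le k (endp l)).trans ?_
      gcongr
      exact sqDisp_le_moment l
  have hsum : ∑ e : Fin d × Bool, (1 - (character k (endp [e])).re) = 2 * symbol k := by
    simp only [character_re_singleton, Fintype.sum_prod_type, sum_const, card_univ,
      Fintype.card_bool, symbol, mul_sum, nsmul_eq_mul, Nat.cast_ofNat]
  rw [hsum, abs_le] at h1
  have h2 := H.abs_tsum_laceAct_sub_le
  rw [abs_le] at h2
  have h3 := H.one_sub_tsum_nonneg
  have h4 := H.eps_nonneg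
  have h5 := H.small
  have h6 := Complex.re_le_norm (1 - walkFourier (laceAct β z) (fun _ => 1) k)
  rw [hre] at h6
  set N := ‖1 - walkFourier (laceAct β z) (fun _ => 1) k‖
  have h7 : symbol k ≤ 8 * d * ((1 - ∑' l, laceAct (d := d) β z l) +
      ∑' l, laceAct (d := d) β z l * (1 - (character k (endp l)).re)) := by
    set S := ∑' l, laceAct (d := d) β z l * (1 - (character k (endp l)).re)
    set T := ∑' l, laceAct (d := d) β z l
    set A := symbol k
    have hAe : A * (16 * (d * ε)) ≤ A * 1 := mul_le_mul_of_nonneg_left h5 hA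
    rcases le_total 1 (4 * (d * z)) with hz | hz
    · have : A * 1 ≤ A * (4 * (d * z)) := mul_le_mul_of_nonneg_left hz hA
      have : 0 ≤ (d : ℝ) * (1 - T) := mul_nonneg (by linarith) h3
      have : (d : ℝ) * (z * (2 * A) - A * ε) ≤ d * S := mul_le_mul_of_nonneg_left (by linarith) (by linarith)
      nlinarith
    · have hzA : 0 ≤ z * (2 * A) := by have := H.hz; positivity
      have : (d : ℝ) * (- (A * ε)) ≤ d * S := mul_le_mul_of_nonneg_left (by linarith) (by linarith)
      have : (d : ℝ) * (1 - ε - 2 * d * z) ≤ d * (1 - T) :=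
        mul_le_mul_of_nonneg_left (by linarith) (by linarith)
      have : (d : ℝ) * (2 * (2 * (d * z))) ≤ d * 1 := by nlinarith
      nlinarith
  calc _ ≤ _ := h7
    _ ≤ _ := by gcongr

lemma walkFourier_laceAct_endp_norm_le (k : Fin d → ℝ) (i : Fin d) :
    ‖walkFourier (laceAct β z) (fun l => (endp l i : ℝ)) k‖ ≤ 2 * √(2 * symbol k) := by
  have hs := summable_norm_walkFourier H.hJ (abs_endp_le i) k
  have hs0 := summable_norm_walkFourier H.hJ (abs_endp_le i) (fun _ => 0)
  have hzero : ∑' l : List (Fin d × Bool), ((laceAct β z l * (endp l i : ℝ) : ℝ) : ℂ) = 0 := by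
    have hinv : Function.Involutive (flipSteps (d := d)) := flipSteps_flipSteps
    have h := hinv.toPerm.tsum_eq
      fun l : List (Fin d × Bool) => ((laceAct β z l * (endp l i : ℝ) : ℝ) : ℂ)
    simp only [Function.Involutive.coe_toPerm, laceAct_flipSteps, endp_flipSteps, Pi.neg_apply,
      Int.cast_neg, mul_neg, Complex.ofReal_neg, tsum_neg] at h
    exact self_eq_neg.1 h.symm
  have hs0' : Summable fun l : List (Fin d × Bool) => ((laceAct β z l * (endp l i : ℝ) : ℝ) : ℂ) := by
    simpa [character] using hs0.of_norm
  rw [walkFourier, ← sub_zero (tsum _), ← hzero, ← hs.of_norm.tsum_sub hs0']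
  have hb : ∀ l : List (Fin d × Bool), ‖((laceAct β z l * (endp l i : ℝ) : ℝ) : ℂ) *
      character k (endp l) - ((laceAct β z l * (endp l i : ℝ) : ℝ) : ℂ)‖ ≤
      |laceAct β z l| * sqDisp l * √(2 * symbol k) := by
    intro l
    rw [← mul_sub_one, norm_mul, Complex.norm_real, Real.norm_eq_abs, abs_mul, mul_assoc, mul_assoc]
    refine mul_le_mul_of_nonneg_left ?_ (abs_nonneg _)
    have h1 : |(endp l i : ℝ)| ≤ √(sqDisp l) := Real.abs_le_sqrt (sq_endp_le l i)
    have h2 : ‖character k (endp l) - 1‖ ≤ √(sqDisp l) * √(2 * symbol k) := by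
      rw [← Real.sqrt_mul (sqDisp_nonneg l)]
      refine Real.le_sqrt_of_sq_le ((norm_character_sub_one_sq_le k (endp l)).trans (le_of_eq ?_))
      rw [sqDisp]; ring
    calc _ ≤ √(sqDisp l) * (√(sqDisp l) * √(2 * symbol k)) := by gcongr
      _ = _ := by rw [← mul_assoc, Real.mul_self_sqrt (sqDisp_nonneg l)]
  refine (tsum_of_norm_bounded (H.summable_abs_mul_sqDisp.mul_right _).hasSum hb).trans ?_
  rw [tsum_mul_right]
  gcongr
  exact H.tsum_abs_mul_sqDisp_le

lemma walkFourier_laceAct_endp_sq_norm_le (k : Fin d → ℝ) (i : Fin d) :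
    ‖walkFourier (laceAct β z) (fun l => (endp l i : ℝ) ^ 2) k‖ ≤ 2 := by
  refine (tsum_of_norm_bounded H.summable_abs_mul_sqDisp.hasSum fun l => ?_).trans
    H.tsum_abs_mul_sqDisp_le
  rw [norm_mul, norm_character, mul_one, Complex.norm_real, Real.norm_eq_abs, abs_mul,
    abs_of_nonneg (sq_nonneg (endp l i : ℝ))]
  gcongr
  exact sq_endp_le l i

lemma symbol_mul_norm_le (k : Fin d → ℝ) :
    symbol k * ‖walkFourier (walkAct β z) (fun _ => 1) k‖ ≤ 8 * d := by
  have h := walkFourier_one H.hK H.hJ k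
  have h2 := H.symbol_le_norm k
  set G := walkFourier (walkAct β z) (fun _ => 1) k
  set J := walkFourier (laceAct β z) (fun _ => 1) k
  have h3 : (1 - J) * G = 1 := by linear_combination h
  have h4 : ‖1 - J‖ * ‖G‖ = 1 := by rw [← norm_mul, h3, norm_one]
  calc _ ≤ 8 * d * ‖1 - J‖ * ‖G‖ := by gcongr
    _ = _ := by rw [mul_assoc, h4, mul_one]

lemma symbol_sq_mul_norm_le (k : Fin d → ℝ) (i : Fin d) :
    symbol k ^ 2 * ‖walkFourier (walkAct β z) (fun l => (endp l i : ℝ) ^ 2) k‖ ≤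
      128 * d ^ 2 + 8192 * d ^ 3 := by
  have hA := symbol_nonneg k
  have h := walkFourier_one H.hK H.hJ k
  have hx := walkFourier_endp H.hK H.hJ k i
  have hxx := walkFourier_endp_sq H.hK H.hJ k i
  have hG := H.symbol_mul_norm_le k
  have hJ1 := H.walkFourier_laceAct_endp_norm_le k i
  have hJ2 := H.walkFourier_laceAct_endp_sq_norm_le k i
  set G := walkFourier (walkAct β z) (fun _ => 1) k
  set J := walkFourier (laceAct β z) (fun _ => 1) k
  set G1 := walkFourier (walkAct β z) (fun l => (endp l i : ℝ)) k
  set J1 := walkFourier (laceAct β z) (fun l => (endp l i : ℝ)) k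
  set G2 := walkFourier (walkAct β z) (fun l => (endp l i : ℝ) ^ 2) k
  set J2 := walkFourier (laceAct β z) (fun l => (endp l i : ℝ) ^ 2) k
  have e : G2 = J2 * G ^ 2 + 2 * J1 ^ 2 * G ^ 3 := by
    have hG1 : G1 = J1 * G ^ 2 := by linear_combination (-G1) * h + G * hx
    rw [hG1] at hxx
    linear_combination (-G2) * h + G * hxx
  have hJ1' : ‖J1‖ ^ 2 ≤ 8 * symbol k := by
    calc ‖J1‖ ^ 2 ≤ (2 * √(2 * symbol k)) ^ 2 := by gcongr
      _ = _ := by rw [mul_pow, Real.sq_sqrt (by positivity)]; ring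
  calc _ ≤ symbol k ^ 2 * (‖J2‖ * ‖G‖ ^ 2 + 2 * ‖J1‖ ^ 2 * ‖G‖ ^ 3) := by
        rw [e]
        gcongr
        refine (norm_add_le _ _).trans (le_of_eq ?_)
        simp
    _ ≤ symbol k ^ 2 * (2 * ‖G‖ ^ 2 + 2 * (8 * symbol k) * ‖G‖ ^ 3) := by gcongr
    _ = 2 * (symbol k * ‖G‖) ^ 2 + 16 * (symbol k * ‖G‖) ^ 3 := by ring
    _ ≤ 2 * (8 * d) ^ 2 + 16 * (8 * d) ^ 3 := by gcongr
    _ = _ := by ring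

end Perturbative

end WSAW

namespace WSAW
open Finset MeasureTheory
open scoped ENNReal NNReal Real

variable {d : ℕ} {β z ε : ℝ}

/-- The bubble diagram of the simple random walk, up to a constant. -/
noncomputable def greenSq (d : ℕ) : ℝ≥0∞ :=
  ∫⁻ k, ENNReal.ofReal (symbol k) ^ (-2 : ℝ) ∂(zoneMeasure d)

lemma tsum_ite_le_greenSq {ι : Type*} [Countable ι] {a : ι → ℝ} (ha : ∀ i, 0 ≤ a i)
    (hs : Summable a) (p : ι → Fin d → ℤ) {C : ℝ} (hC : 0 < C)
    (h : ∀ k, symbol k ^ 2 * ‖∑' i, (a i : ℂ) * character k (p i)‖ ≤ C) :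
    ∑' i, (if p i = 0 then ENNReal.ofReal (a i) else 0) ≤ ENNReal.ofReal C * greenSq d := by
  have hn : ∀ i, 0 ≤ (if p i = 0 then a i else 0) := fun i => by split_ifs <;> simp [ha i]
  have hs' : Summable fun i => (if p i = 0 then a i else 0) :=
    Summable.of_nonneg_of_le hn (fun i => by split_ifs <;> simp [ha i]) hs
  have e1 : ∑' i, (if p i = 0 then ENNReal.ofReal (a i) else 0) =
      ENNReal.ofReal (∑' i, if p i = 0 then a i else 0) := by
    rw [ENNReal.ofReal_tsum_of_nonneg hn hs']
    refine tsum_congr fun i => ?_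
    split_ifs <;> simp
  have e2 := integral_tsum_character (a := fun i => (a i : ℂ)) (by simpa using hs.norm) p
  have e3 : (∑' i, if p i = 0 then (a i : ℂ) else 0) =
      ((∑' i, if p i = 0 then a i else 0 : ℝ) : ℂ) := by
    rw [Complex.ofReal_tsum]
    refine tsum_congr fun i => ?_
    split_ifs <;> simp
  have e4 : ENNReal.ofReal (∑' i, if p i = 0 then a i else 0) =
      ‖∫ k, ∑' i, (a i : ℂ) * character k (p i) ∂(zoneMeasure d)‖ₑ := by
    rw [e2, e3, ← ofReal_norm, Complex.norm_real, Real.norm_of_nonneg (tsum_nonneg hn)]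
  rw [e1, e4]
  refine (enorm_integral_le_lintegral_enorm _).trans ?_
  rw [greenSq, ← lintegral_const_mul' _ _ ENNReal.ofReal_ne_top]
  refine lintegral_mono fun k => ?_
  rcases (symbol_nonneg k).eq_or_lt with h0 | h0
  · rw [← h0, ENNReal.ofReal_zero, ENNReal.zero_rpow_of_neg (by norm_num), ENNReal.mul_top]
    · exact le_top
    · simpa using hC
  · rw [ENNReal.ofReal_rpow_of_pos h0, ← ENNReal.ofReal_mul hC.le, ← ofReal_norm]
    refine ENNReal.ofReal_le_ofReal ?_
    rw [Real.rpow_neg h0.le, Real.rpow_two, ← div_eq_mul_inv, le_div_iff₀ (by positivity), mul_comm]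
    exact h k

lemma actWeight_eq (h1 : β ≤ 1) (hz : 0 ≤ z) (l : List (Fin d × Bool)) :
    actWeight β z l = ENNReal.ofReal (walkAct β z l) := by
  rw [actWeight, walkAct, ENNReal.ofReal_mul (walkWeight_nonneg h1 l), ENNReal.ofReal_pow hz]

lemma tsum_twoPoint_sq (h1 : β ≤ 1) (hz : 0 ≤ z) :
    ∑' x, twoPoint (d := d) β z (fun _ => 1) x ^ 2 =
      ∑' p : List (Fin d × Bool) × List (Fin d × Bool),
        (if endp p.1 - endp p.2 = 0 then ENNReal.ofReal (walkAct β z p.1 * walkAct β z p.2)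
          else 0) := by
  simp only [sq]
  rw [← tsum_actWeight_mul β z (fun _ => 1) (twoPoint β z fun _ => 1), ENNReal.tsum_prod']
  refine tsum_congr fun a => ?_
  simp only [twoPoint, mul_one, ← ENNReal.tsum_mul_left]
  refine tsum_congr fun b => ?_
  rw [actWeight_eq h1 hz, actWeight_eq h1 hz, ENNReal.ofReal_mul (walkAct_nonneg h1 hz a)]
  by_cases h : endp b = endp a
  · simp [h]
  · have : ¬ endp a - endp b = 0 := fun h' => h (sub_eq_zero.1 h').symm
    simp [h, this]

lemma moment_eq (l : List (Fin d × Bool)) :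
    moment l = l.length + ∑ i, ENNReal.ofReal ((endp l i : ℝ) ^ 2) := by
  have : ∀ n : ℤ, ENNReal.ofReal ((n : ℝ) ^ 2) = (n.natAbs : ℝ≥0∞) ^ 2 := fun n => by
    rw [← sq_abs, ← Int.cast_abs, Int.abs_eq_natAbs, Int.cast_natCast,
      ENNReal.ofReal_pow (Nat.cast_nonneg _), ENNReal.ofReal_natCast]
  simp [moment, momentWeight, this]

namespace Perturbative
variable (H : Perturbative d β z ε)
include H

lemma tsum_twoPoint_sq_le :
    ∑' x, twoPoint (d := d) β z (fun _ => 1) x ^ 2 ≤ ENNReal.ofReal (64 * d ^ 2) * greenSq d := by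
  have hd : (1 : ℝ) ≤ d := by exact_mod_cast H.dim
  have hw := fun l => walkAct_nonneg (d := d) H.h1 H.hz l
  rw [tsum_twoPoint_sq H.h1 H.hz]
  refine tsum_ite_le_greenSq (fun p => mul_nonneg (hw _) (hw _))
    (H.summable_walkAct.mul_of_nonneg H.summable_walkAct hw hw) _ (by positivity) fun k => ?_
  have s1 := summable_norm_walkFourier H.hK abs_one_le k
  have s2 : Summable fun l : List (Fin d × Bool) =>
      ‖(starRingEnd ℂ) (((walkAct β z l * 1 : ℝ) : ℂ) * character k (endp l))‖ := by
    simpa only [Complex.norm_conj] using s1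
  have e : ∑' p : List (Fin d × Bool) × List (Fin d × Bool),
      ((walkAct β z p.1 * walkAct β z p.2 : ℝ) : ℂ) * character k (endp p.1 - endp p.2) =
      walkFourier (walkAct β z) (fun _ => 1) k *
        (starRingEnd ℂ) (walkFourier (walkAct β z) (fun _ => 1) k) := by
    rw [walkFourier, Complex.conj_tsum, tsum_mul_tsum_of_summable_norm s1 s2]
    refine tsum_congr fun p => ?_
    rw [sub_eq_add_neg, character_add, character_neg, map_mul, Complex.conj_ofReal]
    push_cast; ring
  rw [e, norm_mul, Complex.norm_conj, ← sq, ← mul_pow]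
  calc _ ≤ (8 * (d : ℝ)) ^ 2 := by
        exact pow_le_pow_left₀ (mul_nonneg (symbol_nonneg k) (norm_nonneg _))
          (H.symbol_mul_norm_le k) 2
    _ = _ := by ring

lemma twoPoint_sq_le (i : Fin d) (x : Fin d → ℤ) :
    twoPoint β z (fun l => ENNReal.ofReal ((endp l i : ℝ) ^ 2)) x ≤
      ENNReal.ofReal (128 * d ^ 2 + 8192 * d ^ 3) * greenSq d := by
  have hd : (1 : ℝ) ≤ d := by exact_mod_cast H.dim
  have hw := fun l => walkAct_nonneg (d := d) H.h1 H.hz l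
  have e : twoPoint β z (fun l => ENNReal.ofReal ((endp l i : ℝ) ^ 2)) x = ∑' l,
      (if endp l - x = 0 then ENNReal.ofReal (walkAct β z l * (endp l i : ℝ) ^ 2) else 0) := by
    refine tsum_congr fun l => ?_
    simp only [sub_eq_zero, actWeight_eq H.h1 H.hz, ENNReal.ofReal_mul (hw l)]
  rw [e]
  have s := fun k => summable_norm_walkFourier H.hK (abs_endp_sq_le i) k
  refine tsum_ite_le_greenSq (fun l => mul_nonneg (hw _) (sq_nonneg _)) ?_ _ (by positivity)
    fun k => ?_
  · have := s 0
    simp only [norm_mul, norm_character, mul_one, Complex.norm_real] at this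
    exact Summable.of_norm (by simpa only [norm_mul] using this)
  · have : ∑' l, ((walkAct β z l * (endp l i : ℝ) ^ 2 : ℝ) : ℂ) * character k (endp l - x) =
        walkFourier (walkAct β z) (fun l => (endp l i : ℝ) ^ 2) k * character k (-x) := by
      rw [walkFourier, ← tsum_mul_right]
      refine tsum_congr fun l => ?_
      rw [sub_eq_add_neg, character_add]; ring
    rw [this, norm_mul, norm_character, mul_one]
    exact H.symbol_sq_mul_norm_le k i

end Perturbative

end WSAW

namespace WSAW
open Finset MeasureTheory
open scoped ENNReal NNReal Real

variable {d : ℕ} {β z : ℝ}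

lemma continuousOn_tsum_mul_pow {ι : Type*} {c : ι → ℝ} {n : ι → ℕ} {b : ℝ} (hc : ∀ i, 0 ≤ c i)
    (hs : Summable fun i => c i * b ^ n i) :
    ContinuousOn (fun z => ∑' i, c i * z ^ n i) (Set.Icc 0 b) := by
  refine continuousOn_tsum (fun i => by fun_prop) hs fun i x hx => ?_
  rw [Real.norm_of_nonneg (mul_nonneg (hc i) (pow_nonneg hx.1 _))]
  exact mul_le_mul_of_nonneg_left (pow_le_pow_left₀ hx.1 hx.2 _) (hc i)

lemma abs_walkAct_mul_eq (h1 : β ≤ 1) (hz : 0 ≤ z) (l : List (Fin d × Bool)) :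
    |walkAct β z l| * (1 + momentWeight l) =
      (walkWeight β l * (1 + momentWeight l)) * z ^ l.length := by
  rw [abs_of_nonneg (walkAct_nonneg h1 hz l), walkAct]; ring

lemma summable_moment_of_le (h1 : β ≤ 1) {b : ℝ} (hz : 0 ≤ z) (hzb : z ≤ b)
    (hb : Summable fun l : List (Fin d × Bool) => |walkAct β b l| * (1 + momentWeight l)) :
    Summable fun l : List (Fin d × Bool) => |walkAct β z l| * (1 + momentWeight l) := by
  refine Summable.of_nonneg_of_le (fun l => by positivity) (fun l => ?_) hb
  rw [abs_walkAct_mul_eq h1 hz, abs_walkAct_mul_eq h1 (hz.trans hzb)]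
  have := walkWeight_nonneg h1 l
  gcongr

/-- The bubble diagram as a real power series. -/
noncomputable def bubble (d : ℕ) (β z : ℝ) : ℝ :=
  ∑' p : List (Fin d × Bool) × List (Fin d × Bool),
    (if endp p.1 = endp p.2 then walkWeight β p.1 * walkWeight β p.2 else 0) *
      z ^ (p.1.length + p.2.length)

/-- The second moment weighted two-point function as a real power series. -/
noncomputable def dispMoment (β z : ℝ) (i : Fin d) (x : Fin d → ℤ) : ℝ :=
  ∑' l : List (Fin d × Bool),
    (if endp l = x then walkWeight β l * (endp l i : ℝ) ^ 2 else 0) * z ^ l.length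

section
variable (h1 : β ≤ 1) {b : ℝ} (hb0 : 0 ≤ b)
  (hb : Summable fun l : List (Fin d × Bool) => |walkAct β b l| * (1 + momentWeight l))
include h1 hb0 hb

lemma summable_bubble : Summable fun p : List (Fin d × Bool) × List (Fin d × Bool) =>
    (if endp p.1 = endp p.2 then walkWeight β p.1 * walkWeight β p.2 else 0) *
      b ^ (p.1.length + p.2.length) := by
  have hw := fun l => walkAct_nonneg (d := d) h1 hb0 l
  have hs : Summable (walkAct (d := d) β b) := by
    refine Summable.of_norm_bounded hb fun l => ?_
    rw [Real.norm_eq_abs]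
    exact le_mul_of_one_le_right (abs_nonneg _) (by simp)
  have hK := fun l : List (Fin d × Bool) => walkWeight_nonneg h1 l
  refine Summable.of_nonneg_of_le (fun p => ?_) (fun p => ?_) (hs.mul_of_nonneg hs hw hw)
  · have := mul_nonneg (hK p.1) (hK p.2)
    split_ifs <;> positivity
  · have := mul_nonneg (hw p.1) (hw p.2)
    split_ifs
    · rw [walkAct, walkAct, pow_add]; apply le_of_eq; ring
    · simpa using this

lemma summable_dispMoment (i : Fin d) (x : Fin d → ℤ) : Summable fun l : List (Fin d × Bool) =>
    (if endp l = x then walkWeight β l * (endp l i : ℝ) ^ 2 else 0) * b ^ l.length := by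
  have hK := fun l : List (Fin d × Bool) => walkWeight_nonneg h1 l
  refine Summable.of_nonneg_of_le (fun l => ?_) (fun l => ?_) hb
  · have := mul_nonneg (hK l) (sq_nonneg (endp l i : ℝ))
    split_ifs <;> positivity
  · rw [abs_walkAct_mul_eq h1 hb0]
    have := hK l
    have h2 := (sq_endp_le l i).trans (sqDisp_le_moment l)
    split_ifs
    · gcongr; linarith
    · rw [zero_mul]; positivity

lemma ofReal_bubble : ENNReal.ofReal (bubble d β b) =
    ∑' x, twoPoint (d := d) β b (fun _ => 1) x ^ 2 := by
  have hK := fun l : List (Fin d × Bool) => walkWeight_nonneg h1 l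
  rw [tsum_twoPoint_sq h1 hb0, bubble, ENNReal.ofReal_tsum_of_nonneg (fun p => ?_)
    (summable_bubble h1 hb0 hb)]
  · refine tsum_congr fun p => ?_
    simp only [sub_eq_zero, walkAct, pow_add]
    split_ifs
    · congr 1; ring
    · simp
  · have := mul_nonneg (hK p.1) (hK p.2)
    split_ifs <;> positivity

lemma ofReal_dispMoment (i : Fin d) (x : Fin d → ℤ) : ENNReal.ofReal (dispMoment β b i x) =
    twoPoint β b (fun l => ENNReal.ofReal ((endp l i : ℝ) ^ 2)) x := by
  have hK := fun l : List (Fin d × Bool) => walkWeight_nonneg h1 l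
  rw [twoPoint, dispMoment, ENNReal.ofReal_tsum_of_nonneg (fun l => ?_)
    (summable_dispMoment h1 hb0 hb i x)]
  · refine tsum_congr fun l => ?_
    rw [actWeight_eq h1 hb0, ← ENNReal.ofReal_mul (walkAct_nonneg h1 hb0 l), walkAct]
    split_ifs
    · congr 1; ring
    · simp
  · have := mul_nonneg (hK l) (sq_nonneg (endp l i : ℝ))
    split_ifs <;> positivity

end

lemma dispMoment_sub_le (h1 : β ≤ 1) {b y : ℝ}
    (hb : Summable fun l : List (Fin d × Bool) => |walkAct β b l| * (1 + momentWeight l))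
    (hy : y ∈ Set.Icc 0 b) (hz : z ∈ Set.Icc 0 y) (i : Fin d)
    (x : Fin d → ℤ) : dispMoment β y i x - dispMoment β z i x ≤
      (∑' l : List (Fin d × Bool), (walkWeight β l * (1 + momentWeight l)) * y ^ l.length) -
      ∑' l : List (Fin d × Bool), (walkWeight β l * (1 + momentWeight l)) * z ^ l.length := by
  have hzb := hz.2.trans hy.2
  have sy := summable_moment_of_le h1 hy.1 hy.2 hb
  have sz := summable_moment_of_le h1 hz.1 hzb hb
  have s1 := summable_dispMoment h1 hy.1 sy i x
  have s2 := summable_dispMoment h1 hz.1 sz i x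
  simp only [abs_walkAct_mul_eq h1 hy.1, abs_walkAct_mul_eq h1 hz.1] at sy sz
  rw [dispMoment, dispMoment, ← s1.tsum_sub s2, ← sy.tsum_sub sz]
  refine (s1.sub s2).tsum_le_tsum (fun l => ?_) (sy.sub sz)
  rw [← mul_sub, ← mul_sub]
  have hp : 0 ≤ y ^ l.length - z ^ l.length := sub_nonneg.2 (pow_le_pow_left₀ hz.1 hz.2 _)
  refine mul_le_mul_of_nonneg_right ?_ hp
  have := walkWeight_nonneg h1 l
  have h2 := (sq_endp_le l i).trans (sqDisp_le_moment l)
  split_ifs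
  · gcongr; linarith
  · positivity

/-- Bounds on the bubble and on the displacement moments make the lace expansion perturbative. -/
lemma perturbative_of_bounds (hd : 0 < d) (h0 : 0 ≤ β) (h1 : β ≤ 1 / 2) (hz : 0 ≤ z)
    (hK : Summable fun l : List (Fin d × Bool) => |walkAct β z l| * (1 + momentWeight l))
    {B M : ℝ} (hB0 : 0 ≤ B) (hM0 : 0 ≤ M) (hB : bubble d β z ≤ B)
    (hM : ∀ i x, dispMoment (d := d) β z i x ≤ M) (hs : 64 * (β * B) ≤ 1)
    (hε : 16 * (d * (4 * β * (2 * B + d * M))) ≤ 1) :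
    Perturbative d β z (4 * β * (2 * B + d * M)) := by
  have h1' : β ≤ 1 := by linarith
  have hD0 : 0 ≤ 2 * B + d * M := by positivity
  have hBE : ∑' x, twoPoint (d := d) β z (fun _ => 1) x ^ 2 ≤ (B.toNNReal : ℝ≥0∞) := by
    rw [← ofReal_bubble h1' hz hK]; exact ENNReal.ofReal_le_ofReal hB
  have hDE : ∀ x, twoPoint (d := d) β z moment x ≤ ((2 * B + d * M).toNNReal : ℝ≥0∞) := by
    intro x
    have e : twoPoint (d := d) β z moment x =
        twoPoint β z (fun l => (l.length : ℝ≥0∞)) x +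
          ∑ i, twoPoint β z (fun l => ENNReal.ofReal ((endp l i : ℝ) ^ 2)) x := by
      simp only [twoPoint]
      rw [← Summable.tsum_finsetSum fun _ _ => ENNReal.summable, ← ENNReal.tsum_add]
      refine tsum_congr fun l => ?_
      rw [moment_eq]
      split_ifs
      · rw [mul_add, mul_sum]
      · simp
    rw [e]
    calc _ ≤ 2 * ENNReal.ofReal B + ∑ _i : Fin d, ENNReal.ofReal M := by
          refine add_le_add (twoPoint_length_le h0 h1' hBE x) (sum_le_sum fun i _ => ?_)
          rw [← ofReal_dispMoment h1' hz hK]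
          exact ENNReal.ofReal_le_ofReal (hM i x)
      _ = ENNReal.ofReal (2 * B + d * M) := by
          rw [ENNReal.ofReal_add (by positivity) (by positivity), ENNReal.ofReal_mul (by norm_num),
            ENNReal.ofReal_mul (by positivity)]
          simp
  have key := tsum_laceWeight_moment_le h0 h1 hBE hDE
    (by rw [Real.coe_toNNReal _ hB0]; exact hs)
  have e : ∀ l : List (Fin d × Bool), (if 2 ≤ l.length then
      ENNReal.ofReal |laceWeight β l| * ENNReal.ofReal z ^ l.length * moment l else 0) =
      ENNReal.ofReal (if 2 ≤ l.length then |laceAct β z l| * momentWeight l else 0) := by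
    intro l
    split_ifs
    · rw [laceAct, abs_mul, abs_of_nonneg (pow_nonneg hz _), ENNReal.ofReal_mul (by positivity),
        ENNReal.ofReal_mul (by positivity), ENNReal.ofReal_pow hz, ENNReal.ofReal_natCast, moment]
    · simp
  have key' : ∑' l : List (Fin d × Bool), ENNReal.ofReal
      (if 2 ≤ l.length then |laceAct β z l| * momentWeight l else 0) ≤
      ENNReal.ofReal (4 * β * (2 * B + d * M)) := by
    simp only [e] at key
    rwa [ENNReal.ofReal_mul (by positivity)]
  have nn : ∀ l : List (Fin d × Bool),
      0 ≤ (if 2 ≤ l.length then |laceAct β z l| * momentWeight l else 0) := fun l => by positivity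
  have hsum : Summable fun l : List (Fin d × Bool) =>
      (if 2 ≤ l.length then |laceAct β z l| * momentWeight l else 0) := by
    have := ENNReal.summable_toReal (key'.trans_lt ENNReal.ofReal_lt_top).ne
    simpa only [ENNReal.toReal_ofReal (nn _)] using this
  refine ⟨hd, h1', hz, hK, ?_, ?_, hε⟩
  · refine Summable.of_nonneg_of_le (fun l => by positivity) (fun l => ?_)
      ((hsum.mul_left 2).add (hasSum_length_one fun l =>
        |laceAct β z l| * (1 + momentWeight l)).summable)
    rcases lt_trichotomy l.length 1 with h | h | h
    · have : l = [] := List.length_eq_zero_iff.1 (by omega)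
      subst this; simp [laceAct_nil]
    · simp [h]
    · have h2 : 2 ≤ l.length := h
      have := one_le_moment h2
      rw [if_pos h2, if_neg (by omega), add_zero]
      nlinarith [abs_nonneg (laceAct β z l)]
  · rw [← ENNReal.ofReal_le_ofReal_iff (by positivity), ENNReal.ofReal_tsum_of_nonneg nn hsum]
    exact key'

/-- The bootstrap argument. -/
lemma perturbative_of_summable (hd : 4 < d) {B M : ℝ}
    (hB : 64 * d ^ 2 * (greenSq d).toReal + 1 ≤ B)
    (hM : (128 * d ^ 2 + 8192 * d ^ 3) * (greenSq d).toReal + 1 ≤ M)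
    (h0 : 0 ≤ β) (h1 : β ≤ 1 / 2) (hs : 64 * (β * B) ≤ 1)
    (hε : 16 * (d * (4 * β * (2 * B + d * M))) ≤ 1) {b : ℝ} (hb0 : 0 ≤ b)
    (hb : Summable fun l : List (Fin d × Bool) => |walkAct β b l| * (1 + momentWeight l)) :
    Perturbative d β b (4 * β * (2 * B + d * M)) := by
  have h1' : β ≤ 1 := by linarith
  have hG : greenSq d = ENNReal.ofReal (greenSq d).toReal :=
    (ENNReal.ofReal_toReal (lintegral_symbol_lt_top hd).ne).symm
  have hG0 := (greenSq d).toReal_nonneg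
  have hB1 : 1 ≤ B := le_trans (by simp; positivity) hB
  have hM1 : 0 ≤ M := le_trans (by positivity) hM
  have hKn := fun l : List (Fin d × Bool) => walkWeight_nonneg h1' l
  have sz : ∀ {z}, z ∈ Set.Icc 0 b → Summable fun l : List (Fin d × Bool) =>
    |walkAct β z l| * (1 + momentWeight l) := fun hz => summable_moment_of_le h1' hz.1 hz.2 hb
  have P : ∀ {z}, z ∈ Set.Icc 0 b → bubble d β z ≤ B →
      (∀ i x, dispMoment (d := d) β z i x ≤ M) → Perturbative d β z (4 * β * (2 * B + d * M)) :=
    fun hz h h' => perturbative_of_bounds (by omega) h0 h1 hz.1 (sz hz) (by linarith) hM1 h h' hs hε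
  have cB : ContinuousOn (bubble d β) (Set.Icc 0 b) :=
    continuousOn_tsum_mul_pow (fun p => by
      have := mul_nonneg (hKn p.1) (hKn p.2)
      split_ifs <;> positivity) (summable_bubble h1' hb0 hb)
  have cM : ∀ i x, ContinuousOn (fun z => dispMoment (d := d) β z i x) (Set.Icc 0 b) := fun i x =>
    continuousOn_tsum_mul_pow (fun l => by
      have := mul_nonneg (hKn l) (sq_nonneg (endp l i : ℝ))
      split_ifs <;> positivity) (summable_dispMoment h1' hb0 hb i x)
  have cQ : ContinuousOn (fun z => ∑' l : List (Fin d × Bool),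
      (walkWeight β l * (1 + momentWeight l)) * z ^ l.length) (Set.Icc 0 b) := by
    refine continuousOn_tsum_mul_pow (fun l => ?_) ?_
    · have := hKn l
      positivity
    · simpa only [abs_walkAct_mul_eq h1' hb0] using hb
  let S : Set ℝ := {z | bubble d β z ≤ B ∧ ∀ i x, dispMoment (d := d) β z i x ≤ M}
  have hS : Set.Icc 0 b ⊆ S := by
    refine IsClosed.Icc_subset_of_forall_exists_gt ?_ ?_ ?_
    · have : S ∩ Set.Icc 0 b = (Set.Icc 0 b ∩ bubble d β ⁻¹' Set.Iic B) ∩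
          ⋂ i : Fin d, ⋂ x : Fin d → ℤ,
            (Set.Icc 0 b ∩ (fun z => dispMoment (d := d) β z i x) ⁻¹' Set.Iic M) := by
        ext z
        simp only [S, Set.mem_inter_iff, Set.mem_ofPred_eq, Set.mem_iInter, Set.mem_preimage,
          Set.mem_Iic]
        constructor
        · rintro ⟨⟨h, h'⟩, h''⟩; exact ⟨⟨h'', h⟩, fun i x => ⟨h'', h' i x⟩⟩
        · rintro ⟨⟨h'', h⟩, h'⟩; exact ⟨⟨h, fun i x => (h' i x).2⟩, h''⟩
      rw [this]
      exact (cB.preimage_isClosed_of_isClosed isClosed_Icc isClosed_Iic).inter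
        (isClosed_iInter fun i => isClosed_iInter fun x =>
          (cM i x).preimage_isClosed_of_isClosed isClosed_Icc isClosed_Iic)
    · have hz0 : ∀ l : List (Fin d × Bool), l ≠ [] → (0 : ℝ) ^ l.length = 0 := fun l hl =>
        zero_pow (by simpa using hl)
      refine ⟨?_, fun i x => ?_⟩
      · rw [bubble, tsum_eq_single ([], [])]
        · simpa [walkWeight_nil] using hB1
        · rintro ⟨l, l'⟩ h
          have : l.length + l'.length ≠ 0 := by
            rintro h'
            rw [Nat.add_eq_zero_iff, List.length_eq_zero_iff, List.length_eq_zero_iff] at h'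
            exact h (Prod.ext h'.1 h'.2)
          simp [zero_pow this]
      · rw [dispMoment, tsum_eq_single []]
        · simpa [endp_nil] using hM1
        · intro l hl; rw [hz0 l hl, mul_zero]
    · rintro z ⟨⟨h, h'⟩, hz⟩ y hy
      have hzb : z ∈ Set.Icc 0 b := ⟨hz.1, hz.2.le⟩
      have H := P hzb h h'
      have iB : bubble d β z ≤ B - 1 := by
        have := H.tsum_twoPoint_sq_le
        rw [← ofReal_bubble h1' hz.1 (sz hzb), hG, ← ENNReal.ofReal_mul (by positivity),
          ENNReal.ofReal_le_ofReal_iff (by positivity)] at this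
        linarith
      have iM : ∀ i x, dispMoment (d := d) β z i x ≤ M - 1 := fun i x => by
        have := H.twoPoint_sq_le i x
        rw [← ofReal_dispMoment h1' hz.1 (sz hzb), hG, ← ENNReal.ofReal_mul (by positivity),
          ENNReal.ofReal_le_ofReal_iff (by positivity)] at this
        linarith
      have ev : ∀ᶠ w in nhdsWithin z (Set.Ioc z b), bubble d β w < B ∧
          ∑' l : List (Fin d × Bool), (walkWeight β l * (1 + momentWeight l)) * w ^ l.length <
          ∑' l : List (Fin d × Bool), (walkWeight β l * (1 + momentWeight l)) * z ^ l.length + 1 ∧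
          w < y ∧ w ∈ Set.Ioc z b := by
        have hsub : Set.Ioc z b ⊆ Set.Icc 0 b := fun w hw => ⟨hz.1.trans hw.1.le, hw.2⟩
        refine (((cB z hzb).mono hsub).eventually_lt_const (by linarith)).and
          ((((cQ z hzb).mono hsub).eventually_lt_const (by linarith)).and
          (((continuousWithinAt_id).eventually_lt_const hy).and eventually_mem_nhdsWithin))
      have : (nhdsWithin z (Set.Ioc z b)).NeBot := by
        rw [nhdsWithin_Ioc_eq_nhdsGT hz.2]; infer_instance
      obtain ⟨w, hw1, hw2, hw3, hw4⟩ := ev.exists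
      refine ⟨w, ⟨hw1.le, fun i x => ?_⟩, hw4.1, hw3.le⟩
      have := dispMoment_sub_le h1' hb ⟨hz.1.trans hw4.1.le, hw4.2⟩ ⟨hz.1, hw4.1.le⟩ i x
      linarith [iM i x]
  have hbS := hS ⟨hb0, le_rfl⟩
  exact P ⟨hb0, le_rfl⟩ hbS.1 hbS.2

end WSAW

namespace WSAW
open Finset Filter
open scoped Topology

variable {d : ℕ} {β : ℝ}

lemma cZ_eq (n : ℕ) : cZ d β n = ∑ s : Fin n → Fin d × Bool, walkWeight β (List.ofFn s) :=
  sum_congr rfl fun s _ => wsawWeight_eq_walkWeight s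

/-- Sums over walks are sums over lengths and step sequences. -/
lemma hasSum_list_iff {M : Type*} [AddCommMonoid M] [TopologicalSpace M] {α : Type*}
    {f : List α → M} {a : M} :
    HasSum f a ↔ HasSum (fun p : Σ n, Fin n → α => f (List.ofFn p.2)) a :=
  (List.equivSigmaTuple.symm.hasSum_iff (f := f)).symm

lemma summable_list_iff {α : Type*} {f : List α → ℝ} :
    Summable f ↔ Summable fun p : Σ n, Fin n → α => f (List.ofFn p.2) :=
  exists_congr fun _ => hasSum_list_iff

lemma hasSum_length {M : Type*} [AddCommMonoid M] [TopologicalSpace M] [ContinuousAdd M]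
    [RegularSpace M] {α : Type*} [Fintype α] {f : List α → M} {a : M} (hf : HasSum f a) :
    HasSum (fun n => ∑ s : Fin n → α, f (List.ofFn s)) a :=
  (hasSum_list_iff.1 hf).sigma fun _ => hasSum_fintype _

lemma cZ_nonneg (h1 : β ≤ 1) (n : ℕ) : 0 ≤ cZ d β n := by
  rw [cZ_eq]; exact sum_nonneg fun s _ => walkWeight_nonneg h1 _

lemma walkWeight_le_one (h0 : 0 ≤ β) (h1 : β ≤ 1) (l : List (Fin d × Bool)) :
    walkWeight β l ≤ 1 := by
  induction l with
  | nil => simp [walkWeight_nil]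
  | cons e l ih =>
    have hs : walkWeight β [e] ≤ 1 := by
      unfold walkWeight pairProd
      exact
      prod_le_one (fun _ _ => prod_nonneg fun _ _ => interact_nonneg h1 _ _ _) fun _ _ =>
        prod_le_one (fun _ _ => interact_nonneg h1 _ _ _) fun _ _ => interact_le_one h0 _ _ _
    calc _ ≤ walkWeight β [e] * walkWeight β l := walkWeight_append_le h0 h1 [e] l
      _ ≤ 1 := mul_le_one₀ hs (walkWeight_nonneg h1 l) ih

lemma cZ_le (h0 : 0 ≤ β) (h1 : β ≤ 1) (n : ℕ) : cZ d β n ≤ (2 * d : ℝ) ^ n := by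
  rw [cZ_eq]
  calc _ ≤ ∑ _s : Fin n → Fin d × Bool, (1 : ℝ) :=
        sum_le_sum fun s _ => walkWeight_le_one h0 h1 _
    _ = _ := by simp [mul_comm]

lemma one_le_cZ (hd : 0 < d) (h1 : β ≤ 1) (n : ℕ) : 1 ≤ cZ d β n := by
  let e : Fin d × Bool := (⟨0, hd⟩, true)
  have he : ∀ k, endp (List.replicate k e) = k • wsawStep d e := fun k => by
    simp [endp, List.sum_replicate]
  have hw : walkWeight β (List.ofFn fun _ : Fin n => e) = 1 := by
    rw [List.ofFn_const, walkWeight]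
    refine prod_eq_one fun t ht => prod_eq_one fun s hs => ?_
    rw [mem_Ioc, List.length_replicate] at ht
    rw [mem_Ico] at hs
    rw [interact, List.take_replicate, List.take_replicate, he, he, if_neg]
    intro h
    have := congrFun h ⟨0, hd⟩
    simp [wsawStep, e] at this
    omega
  rw [cZ_eq, ← hw]
  exact single_le_sum (f := fun s : Fin n → Fin d × Bool => walkWeight β (List.ofFn s))
    (fun s _ => walkWeight_nonneg h1 _) (mem_univ fun _ : Fin n => e)

lemma cZ_add_le (h0 : 0 ≤ β) (h1 : β ≤ 1) (m n : ℕ) :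
    cZ d β (m + n) ≤ cZ d β m * cZ d β n := by
  rw [cZ_eq, cZ_eq, cZ_eq, ← (Fin.appendEquiv m n).sum_comp, Fintype.sum_prod_type, sum_mul_sum]
  refine sum_le_sum fun a _ => sum_le_sum fun c _ => ?_
  have e : Fin.appendEquiv m n (a, c) = Fin.append a c := rfl
  rw [e, List.ofFn_fin_append]
  exact walkWeight_append_le h0 h1 _ _

lemma cZ_mul_le (h0 : 0 ≤ β) (h1 : β ≤ 1) (n k : ℕ) : cZ d β (n * k) ≤ cZ d β n ^ k := by
  induction k with
  | zero => simp [cZ_eq, walkWeight_nil]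
  | succ k ih =>
    rw [Nat.mul_succ, pow_succ]
    exact (cZ_add_le h0 h1 _ _).trans (mul_le_mul_of_nonneg_right ih (cZ_nonneg h1 n))

section
variable {μ : ℝ} (hμ : HasGrowthConst d β μ)
include hμ

lemma one_le_growth (hd : 0 < d) (h1 : β ≤ 1) : 1 ≤ μ :=
  ge_of_tendsto' hμ fun n => Real.one_le_rpow (one_le_cZ hd h1 n) (by positivity)

lemma growth_le (h0 : 0 ≤ β) (h1 : β ≤ 1) : μ ≤ 2 * d := by
  refine le_of_tendsto hμ ((eventually_ge_atTop 1).mono fun n hn => ?_)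
  calc _ ≤ ((2 * d : ℝ) ^ n) ^ ((n : ℝ)⁻¹) :=
        Real.rpow_le_rpow (cZ_nonneg h1 n) (cZ_le h0 h1 n) (by positivity)
    _ = _ := Real.pow_rpow_inv_natCast (by positivity) (by omega)

lemma growth_pow_le (hd : 0 < d) (h0 : 0 ≤ β) (h1 : β ≤ 1) (n : ℕ) : μ ^ n ≤ cZ d β n := by
  have hμ1 := one_le_growth hμ hd h1
  rcases n.eq_zero_or_pos with rfl | hn
  · simpa using one_le_cZ hd h1 0
  have hlim : Tendsto (fun k : ℕ => cZ d β (n * k) ^ (((n * k : ℕ) : ℝ)⁻¹)) atTop (𝓝 μ) :=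
    hμ.comp (tendsto_id.const_mul_atTop' hn)
  have hle : μ ≤ cZ d β n ^ ((n : ℝ)⁻¹) := by
    refine le_of_tendsto hlim ((eventually_ge_atTop 1).mono fun k hk => ?_)
    calc _ ≤ (cZ d β n ^ k) ^ (((n * k : ℕ) : ℝ)⁻¹) :=
          Real.rpow_le_rpow (cZ_nonneg h1 _) (cZ_mul_le h0 h1 n k) (by positivity)
      _ = ((cZ d β n ^ k) ^ ((k : ℝ)⁻¹)) ^ ((n : ℝ)⁻¹) := by
          rw [← Real.rpow_mul (pow_nonneg (cZ_nonneg h1 _) _), Nat.cast_mul, mul_inv, mul_comm]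
      _ = _ := by rw [Real.pow_rpow_inv_natCast (cZ_nonneg h1 n) (by omega)]
  calc μ ^ n ≤ (cZ d β n ^ ((n : ℝ)⁻¹)) ^ n := pow_le_pow_left₀ (by linarith) hle n
    _ = _ := Real.rpow_inv_natCast_pow (cZ_nonneg h1 n) (by omega)

lemma summable_cZ_mul (hd : 0 < d) (h1 : β ≤ 1) {z : ℝ} (hz : 0 ≤ z) (hzμ : z < μ⁻¹) (k : ℕ) :
    Summable fun n : ℕ => (n : ℝ) ^ k * (cZ d β n * z ^ n) := by
  have hμ0 : 0 < μ := by linarith [one_le_growth hμ hd h1]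
  have h : z * μ < 1 := by rwa [← one_div, lt_div_iff₀ hμ0] at hzμ
  obtain ⟨ν, hν, hzν⟩ : ∃ ν, μ < ν ∧ z * ν < 1 := by
    have hc : ∀ᶠ ν in 𝓝[>] μ, z * ν < 1 :=
      ((continuous_const.mul continuous_id).continuousWithinAt).eventually_lt_const h
    obtain ⟨ν, h1, h2⟩ := (hc.and self_mem_nhdsWithin).exists
    exact ⟨ν, h2, h1⟩
  have hz0 : 0 ≤ z * ν := mul_nonneg hz (hμ0.trans hν).le
  refine summable_of_isBigO_nat (summable_pow_mul_geometric_of_norm_lt_one (r := z * ν) k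
    (by rwa [Real.norm_of_nonneg hz0])) (Asymptotics.IsBigO.of_bound 1 ?_)
  filter_upwards [hμ.eventually_lt_const hν, eventually_ge_atTop 1] with n hn hn1
  have hc := cZ_nonneg (d := d) h1 n
  have hcn : cZ d β n ≤ ν ^ n := by
    calc _ = (cZ d β n ^ ((n : ℝ)⁻¹)) ^ n := (Real.rpow_inv_natCast_pow hc (by omega)).symm
      _ ≤ _ := pow_le_pow_left₀ (Real.rpow_nonneg hc _) hn.le n
  rw [Real.norm_of_nonneg (by positivity), Real.norm_of_nonneg (by positivity), one_mul, mul_pow,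
    mul_comm (z ^ n)]
  gcongr

lemma summable_walkAct_moment (hd : 0 < d) (h1 : β ≤ 1) {z : ℝ} (hz : 0 ≤ z) (hzμ : z < μ⁻¹) :
    Summable fun l : List (Fin d × Bool) => |walkAct β z l| * (1 + momentWeight l) := by
  rw [summable_list_iff, summable_sigma_of_nonneg fun _ => by positivity]
  refine ⟨fun n => (hasSum_fintype _).summable, ?_⟩
  have h := fun k => summable_cZ_mul hμ hd h1 hz hzμ k
  refine Summable.of_nonneg_of_le (fun n => tsum_nonneg fun _ => by positivity) (fun n => ?_)
    (((h 0).add (h 1)).add (h 2))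
  rw [tsum_fintype]
  have hm : ∀ s : Fin n → Fin d × Bool, (momentWeight (List.ofFn s) : ℝ) ≤ n + n ^ 2 := by
    intro s
    have h1 := sum_abs_endp_le (List.ofFn s)
    have h2 : momentWeight (List.ofFn s) ≤ n + n ^ 2 := by
      rw [momentWeight, List.length_ofFn]
      rw [List.length_ofFn] at h1
      have h3 : ∑ i, (endp (List.ofFn s) i).natAbs ≤ n := by
        have : ((∑ i, (endp (List.ofFn s) i).natAbs : ℕ) : ℤ) ≤ n := by
          push_cast; exact h1
        exact_mod_cast this
      have h4 : ∑ i, (endp (List.ofFn s) i).natAbs ^ 2 ≤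
          (∑ i, (endp (List.ofFn s) i).natAbs) ^ 2 :=
        sum_sq_le_sq_sum_of_nonneg fun _ _ => Nat.zero_le _
      exact Nat.add_le_add_left (h4.trans (Nat.pow_le_pow_left h3 2)) n
    exact_mod_cast h2
  calc _ ≤ ∑ s : Fin n → Fin d × Bool, walkWeight β (List.ofFn s) * z ^ n * (1 + (n + n ^ 2)) := by
        refine sum_le_sum fun s _ => ?_
        rw [abs_of_nonneg (walkAct_nonneg h1 hz _), walkAct, List.length_ofFn]
        have := walkWeight_nonneg h1 (List.ofFn s)
        gcongr
        exact hm s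
    _ = _ := by rw [cZ_eq, ← sum_mul, ← sum_mul]; ring

end

end WSAW

namespace WSAW
open Finset Filter
open scoped Topology

/-- The power series `1 - ∑ jₘ zᵐ`. -/
noncomputable def invSeries (j : ℕ → ℝ) (z : ℂ) : ℂ := 1 - ∑' m, (j m : ℂ) * z ^ m

/-- The termwise derivative of `invSeries`. -/
noncomputable def invSeriesDeriv (j : ℕ → ℝ) (z : ℂ) : ℂ :=
  -∑' m : ℕ, (j m : ℂ) * (m * z ^ (m - 1))

section
variable {j : ℕ → ℝ} {r ε : ℝ} (hr : 0 < r) (hj : j 0 = 0)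
  (hs : Summable fun m : ℕ => m * |j m| * r ^ m)

lemma norm_term_le (hj : j 0 = 0) {z : ℂ} (hz : ‖z‖ ≤ r) (m : ℕ) :
    ‖(j m : ℂ) * z ^ m‖ ≤ m * |j m| * r ^ m := by
  rcases m.eq_zero_or_pos with rfl | hm
  · simp [hj]
  · have hm' : (1 : ℝ) ≤ m := by exact_mod_cast hm
    rw [norm_mul, norm_pow, Complex.norm_real, Real.norm_eq_abs]
    gcongr
    exact le_mul_of_one_le_left (abs_nonneg _) hm'

lemma norm_deriv_term_le (hr : 0 < r) {z : ℂ} (hz : ‖z‖ ≤ r) (m : ℕ) :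
    ‖(j m : ℂ) * (m * z ^ (m - 1))‖ ≤ r⁻¹ * (m * |j m| * r ^ m) := by
  rcases m.eq_zero_or_pos with rfl | hm
  · simp
  · obtain ⟨n, rfl⟩ : ∃ n, m = n + 1 := ⟨m - 1, by omega⟩
    rw [norm_mul, norm_mul, norm_pow, Complex.norm_real, Real.norm_eq_abs, Complex.norm_natCast,
      Nat.add_sub_cancel]
    calc _ ≤ |j (n + 1)| * ((n + 1 : ℕ) * r ^ n) := by gcongr
      _ = _ := by rw [pow_succ]; field_simp

lemma norm_tsum_sub_le (hs : Summable fun m : ℕ => m * |j m| * r ^ m)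
    (hε : ∑' m : ℕ, (if 2 ≤ m then m * |j m| * r ^ m else 0) ≤ ε) (hr : 0 ≤ r)
    {f : ℕ → ℂ} {K : ℝ} (hK : 0 ≤ K) (hf0 : f 0 = 0)
    (hf : ∀ m, 2 ≤ m → ‖f m‖ ≤ K * (m * |j m| * r ^ m)) : ‖∑' m, f m - f 1‖ ≤ K * ε := by
  have h2 : Summable fun m : ℕ => (if 2 ≤ m then m * |j m| * r ^ m else 0) := by
    refine Summable.of_nonneg_of_le (fun m => by positivity) (fun m => ?_) hs
    split_ifs
    · rfl
    · positivity
  have hb : ∀ m, ‖if 2 ≤ m then f m else 0‖ ≤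
      K * (if 2 ≤ m then m * |j m| * r ^ m else 0) := fun m => by
    split_ifs with h
    · exact hf m h
    · simp
  have h3 : Summable fun m => if 2 ≤ m then f m else 0 := Summable.of_norm_bounded (h2.mul_left K) hb
  have e : ∀ m, f m = (if m = 1 then f 1 else 0) + if 2 ≤ m then f m else 0 := by
    intro m
    rcases m with _ | _ | m <;> simp [hf0]
  rw [tsum_congr e, (hasSum_ite_eq 1 (f 1)).summable.tsum_add h3, tsum_ite_eq, add_sub_cancel_left]
  calc _ ≤ ∑' m, K * (if 2 ≤ m then m * |j m| * r ^ m else 0) :=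
        tsum_of_norm_bounded (h2.mul_left K).hasSum hb
    _ ≤ _ := by rw [tsum_mul_left]; gcongr

include hj hs in
lemma continuousOn_invSeries : ContinuousOn (invSeries j) {z | ‖z‖ ≤ r} :=
  continuousOn_const.sub
    (continuousOn_tsum (fun m => by fun_prop) hs fun m _ hz => norm_term_le hj hz m)

include hr hs in
lemma continuousOn_invSeriesDeriv : ContinuousOn (invSeriesDeriv j) {z | ‖z‖ ≤ r} :=
  (continuousOn_tsum (fun m => by fun_prop) (hs.mul_left r⁻¹)
    fun m _ hz => norm_deriv_term_le hr hz m).neg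

include hr hj hs in
lemma hasDerivAt_invSeries {z : ℂ} (hz : ‖z‖ < r) :
    HasDerivAt (invSeries j) (invSeriesDeriv j z) z := by
  have hz' : z ∈ Metric.ball (0 : ℂ) r := by simpa using hz
  have h := hasDerivAt_tsum_of_isPreconnected (hs.mul_left r⁻¹) Metric.isOpen_ball
    (convex_ball (0 : ℂ) r).isPreconnected
    (g := fun m (z : ℂ) => (j m : ℂ) * z ^ m) (g' := fun m (z : ℂ) => (j m : ℂ) * (m * z ^ (m - 1)))
    (fun m y _ => (hasDerivAt_pow m y).const_mul (j m : ℂ))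
    (fun m y hy => norm_deriv_term_le hr (by simpa using (Metric.mem_ball.1 hy).le) m)
    hz' (Summable.of_norm_bounded hs fun m => norm_term_le hj hz.le m) hz'
  exact h.const_sub 1

variable (hε : ∑' m : ℕ, (if 2 ≤ m then m * |j m| * r ^ m else 0) ≤ ε)

include hr hs hε in
lemma norm_invSeriesDeriv_add_le {z : ℂ} (hz : ‖z‖ ≤ r) :
    ‖invSeriesDeriv j z + j 1‖ ≤ r⁻¹ * ε := by
  have := norm_tsum_sub_le (f := fun m => (j m : ℂ) * (m * z ^ (m - 1))) hs hε hr.le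
    (inv_nonneg.2 hr.le) (by simp) fun m _ => norm_deriv_term_le hr hz m
  have e : invSeriesDeriv j z + j 1 = -(∑' m, (j m : ℂ) * (m * z ^ (m - 1)) -
      (j 1 : ℂ) * ((1 : ℕ) * z ^ (1 - 1))) := by
    rw [invSeriesDeriv]; simp [sub_eq_add_neg, add_comm]
  rw [e, norm_neg]
  exact this

lemma norm_pow_sub_pow_le {z w : ℂ} (hz : ‖z‖ ≤ r) (hw : ‖w‖ ≤ r) (m : ℕ) :
    ‖z ^ m - w ^ m‖ ≤ m * r ^ (m - 1) * ‖z - w‖ := by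
  rw [← (Commute.all z w).geom_sum₂_mul, norm_mul]
  gcongr
  have hr := (norm_nonneg z).trans hz
  calc _ ≤ ∑ i ∈ range m, r ^ (m - 1) := by
        refine norm_sum_le_of_le _ fun i hi => ?_
        rw [norm_mul, norm_pow, norm_pow]
        have hi := mem_range.1 hi
        calc _ ≤ r ^ i * r ^ (m - 1 - i) := by gcongr
          _ = _ := by rw [← pow_add]; congr 1; omega
    _ = _ := by simp

include hr hj hs hε in
lemma norm_invSeries_sub_ge {z w : ℂ} (hz : ‖z‖ ≤ r) (hw : ‖w‖ ≤ r) :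
    (j 1 - r⁻¹ * ε) * ‖z - w‖ ≤ ‖invSeries j z - invSeries j w‖ := by
  have sm := fun {z : ℂ} (hz : ‖z‖ ≤ r) =>
    Summable.of_norm_bounded hs fun m => norm_term_le hj hz m
  have key := norm_tsum_sub_le (f := fun m => (j m : ℂ) * z ^ m - (j m : ℂ) * w ^ m) hs hε hr.le
    (K := r⁻¹ * ‖z - w‖) (by positivity) (by simp) fun m hm => by
      obtain ⟨n, rfl⟩ : ∃ n, m = n + 1 := ⟨m - 1, by omega⟩
      rw [← mul_sub, norm_mul, Complex.norm_real, Real.norm_eq_abs]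
      calc _ ≤ |j (n + 1)| * ((n + 1 : ℕ) * r ^ n * ‖z - w‖) := by
            gcongr; exact norm_pow_sub_pow_le hz hw (n + 1)
        _ = _ := by rw [pow_succ]; field_simp
  rw [(sm hz).tsum_sub (sm hw), pow_one, pow_one, ← mul_sub] at key
  have e : invSeries j z - invSeries j w =
      -(∑' m, (j m : ℂ) * z ^ m - ∑' m, (j m : ℂ) * w ^ m) := by
    rw [invSeries, invSeries]; ring
  rw [e, norm_neg]
  have h2 := norm_sub_norm_le ((j 1 : ℂ) * (z - w))
    (∑' m, (j m : ℂ) * z ^ m - ∑' m, (j m : ℂ) * w ^ m)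
  rw [norm_sub_rev ((j 1 : ℂ) * (z - w)), norm_mul, Complex.norm_real, Real.norm_eq_abs] at h2
  have h3 := mul_le_mul_of_nonneg_right (le_abs_self (j 1)) (norm_nonneg (z - w))
  nlinarith

include hr hj hs hε in
lemma norm_mul_invSeriesDeriv_le :
    ‖-(r : ℂ) * invSeriesDeriv j r - 1 + invSeries j r‖ ≤ ε := by
  have hz : ‖(r : ℂ)‖ ≤ r := by simp [abs_of_pos hr]
  have s1 := Summable.of_norm_bounded hs fun m => norm_term_le hj hz m
  have s2 := Summable.of_norm_bounded (hs.mul_left r⁻¹)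
    fun m => norm_deriv_term_le (j := j) hr hz m
  have key := norm_tsum_sub_le
    (f := fun m => (r : ℂ) * ((j m : ℂ) * (m * (r : ℂ) ^ (m - 1))) - (j m : ℂ) * (r : ℂ) ^ m)
    hs hε hr.le zero_le_one (by simp [hj]) fun m hm => by
      obtain ⟨n, rfl⟩ : ∃ n, m = n + 1 := ⟨m - 1, by omega⟩
      have e : (r : ℂ) * ((j (n + 1) : ℂ) * ((n + 1 : ℕ) * (r : ℂ) ^ (n + 1 - 1))) -
          (j (n + 1) : ℂ) * (r : ℂ) ^ (n + 1) = ((n * j (n + 1) * r ^ (n + 1) : ℝ) : ℂ) := by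
        rw [Nat.add_sub_cancel, pow_succ]; push_cast; ring
      rw [e, Complex.norm_real, Real.norm_eq_abs, abs_mul, abs_mul, abs_of_pos (pow_pos hr _),
        Nat.abs_cast, one_mul]
      gcongr
      omega
  rw [(s2.mul_left (r : ℂ)).tsum_sub s1, tsum_mul_left] at key
  rw [one_mul] at key
  convert key using 2
  rw [invSeries, invSeriesDeriv]; simp [mul_comm]
end

end WSAW

namespace WSAW
open Finset Filter
open scoped Topology

variable {d : ℕ} {β : ℝ}

/-- The coefficients of the inverse susceptibility. -/
noncomputable def laceSum (d : ℕ) (β : ℝ) (m : ℕ) : ℝ :=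
  ∑ s : Fin m → Fin d × Bool, laceWeight β (List.ofFn s)

lemma laceSum_zero : laceSum d β 0 = 0 := by simp [laceSum]

lemma laceSum_one : laceSum d β 1 = 2 * d := by
  rw [laceSum, sum_congr rfl fun s _ => laceWeight_of_length_one (by simp)]
  simp [mul_comm]

lemma Perturbative.sum_laceSum_le {z ε : ℝ} (H : Perturbative d β z ε) (N : ℕ) :
    ∑ m ∈ range N, (if 2 ≤ m then m * |laceSum d β m| * z ^ m else 0) ≤ ε := by
  have hz := H.hz
  have hs : Summable fun l : List (Fin d × Bool) =>
      if 2 ≤ l.length then |laceAct β z l| * momentWeight l else 0 := by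
    refine Summable.of_nonneg_of_le (fun l => by positivity) (fun l => ?_) H.hJ
    split_ifs
    · gcongr; linarith
    · positivity
  have h := hasSum_length hs.hasSum
  refine le_trans (le_trans (sum_le_sum fun m _ => ?_)
    (h.summable.sum_le_tsum (range N) fun m _ => sum_nonneg fun s _ => by positivity))
    (h.tsum_eq.trans_le H.hε)
  simp only [List.length_ofFn]
  split_ifs
  · calc _ ≤ m * (∑ s : Fin m → Fin d × Bool, |laceWeight β (List.ofFn s)|) * z ^ m := by
          gcongr; exact abs_sum_le_sum_abs _ _
      _ = ∑ s : Fin m → Fin d × Bool, |laceAct β z (List.ofFn s)| * m := by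
          rw [mul_sum, sum_mul]
          refine sum_congr rfl fun s _ => ?_
          rw [laceAct, abs_mul, List.length_ofFn, abs_of_nonneg (pow_nonneg hz m)]; ring
      _ ≤ _ := by
          refine sum_le_sum fun s _ => ?_
          gcongr
          rw [momentWeight, List.length_ofFn]; omega
  · simp

lemma tsum_length_mul_pow {w : List (Fin d × Bool) → ℝ} {r : ℝ} {u : ℂ} (hu : ‖u‖ = 1)
    (hw : Summable fun l : List (Fin d × Bool) => w l * r ^ l.length) :
    Summable (fun l => ‖((w l * r ^ l.length : ℝ) : ℂ) * u ^ l.length‖) ∧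
      ∑' m : ℕ, ((∑ s : Fin m → Fin d × Bool, w (List.ofFn s) : ℝ) : ℂ) * (r * u) ^ m =
        ∑' l : List (Fin d × Bool), ((w l * r ^ l.length : ℝ) : ℂ) * u ^ l.length := by
  have s1 : Summable (fun l => ‖((w l * r ^ l.length : ℝ) : ℂ) * u ^ l.length‖) := by
    simpa only [norm_mul, norm_pow, hu, one_pow, mul_one, Complex.norm_real] using hw.norm
  refine ⟨s1, ?_⟩
  rw [← (hasSum_length s1.of_norm.hasSum).tsum_eq]
  refine tsum_congr fun m => ?_
  simp only [List.length_ofFn]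
  push_cast
  rw [sum_mul]
  refine sum_congr rfl fun s _ => ?_
  rw [mul_pow, mul_assoc]

/-- The susceptibility is the reciprocal of the lace expansion series. -/
lemma Perturbative.chi_mul_invSeries {ε : ℝ} {z : ℂ} (H : Perturbative d β ‖z‖ ε) :
    chi d β z * invSeries (laceSum d β) z = 1 := by
  obtain ⟨u, hu, hz⟩ : ∃ u : ℂ, ‖u‖ = 1 ∧ z = ‖z‖ * u :=
    ⟨Complex.exp (z.arg * Complex.I), Complex.norm_exp_ofReal_mul_I _,
      (Complex.norm_mul_exp_arg_mul_I z).symm⟩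
  obtain ⟨sK, eK⟩ := tsum_length_mul_pow (w := walkWeight β) hu H.summable_walkAct
  obtain ⟨sJ, eJ⟩ := tsum_length_mul_pow (w := laceWeight β) hu H.summable_laceAct
  rw [← hz] at eK eJ
  change Summable fun l => ‖(walkAct β ‖z‖ l : ℂ) * u ^ l.length‖ at sK
  change Summable fun l => ‖(laceAct β ‖z‖ l : ℂ) * u ^ l.length‖ at sJ
  have hchi : chi d β z = ∑' l : List (Fin d × Bool),
      (walkAct β ‖z‖ l : ℂ) * u ^ l.length := by
    rw [chi]; simp only [cZ_eq]; exact eK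
  have e : ∀ p : List (Fin d × Bool) × List (Fin d × Bool),
      (laceAct β ‖z‖ p.1 * walkAct β ‖z‖ p.2 : ℂ) * u ^ (p.1 ++ p.2).length =
      ((laceAct β ‖z‖ p.1 : ℂ) * u ^ p.1.length) * ((walkAct β ‖z‖ p.2 : ℂ) * u ^ p.2.length) :=
    fun p => by rw [List.length_append, pow_add]; ring
  have key := tsum_walkAct (d := d) (β := β) (z := ‖z‖) (φ := fun l => u ^ l.length)
    ((summable_mul_of_summable_norm sJ sK).congr fun p => (e p).symm)
  rw [tsum_congr e, ← hchi, ← tsum_mul_tsum_of_summable_norm sJ sK] at key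
  have hj : ∑' m, (laceSum d β m : ℂ) * z ^ m = ∑' l : List (Fin d × Bool),
      (laceAct β ‖z‖ l : ℂ) * u ^ l.length := eJ
  rw [invSeries, hj]
  have key' : chi d β z = 1 + (∑' l : List (Fin d × Bool),
      (laceAct β ‖z‖ l : ℂ) * u ^ l.length) * chi d β z := by
    simpa only [List.length_nil, pow_zero, ← hchi] using key
  linear_combination key'

section
variable {μ : ℝ} (hμ : HasGrowthConst d β μ) (hd : 0 < d) (h0 : 0 ≤ β) (h1 : β ≤ 1)
include hμ hd h0 h1

lemma inv_one_sub_le_norm_chi {z : ℝ} (hz : 0 ≤ z) (hzμ : z < μ⁻¹) :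
    (1 - μ * z)⁻¹ ≤ ‖chi d β z‖ := by
  have hμ0 : 0 < μ := by linarith [one_le_growth hμ hd h1]
  have h : μ * z < 1 := by rw [mul_comm]; rwa [← one_div, lt_div_iff₀ hμ0] at hzμ
  have s1 : Summable fun n : ℕ => cZ d β n * z ^ n := by
    simpa using summable_cZ_mul hμ hd h1 hz hzμ 0
  have e : chi d β z = ((∑' n : ℕ, cZ d β n * z ^ n : ℝ) : ℂ) := by
    rw [chi, Complex.ofReal_tsum]; push_cast; rfl
  rw [e, Complex.norm_real, Real.norm_eq_abs, ← tsum_geometric_of_lt_one (by positivity) h]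
  refine le_trans (Summable.tsum_le_tsum (fun n => ?_)
    (summable_geometric_of_lt_one (by positivity) h) s1) (le_abs_self _)
  rw [mul_pow]
  exact mul_le_mul_of_nonneg_right (growth_pow_le hμ hd h0 h1 n) (pow_nonneg hz n)

variable {ε : ℝ} (H : ∀ z, 0 ≤ z → z < μ⁻¹ → Perturbative d β z ε)
include H

omit h0 in
lemma laceSum_critical :
    Summable (fun m : ℕ => m * |laceSum d β m| * μ⁻¹ ^ m) ∧
      ∑' m : ℕ, (if 2 ≤ m then m * |laceSum d β m| * μ⁻¹ ^ m else 0) ≤ ε := by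
  have hμ0 : 0 < μ⁻¹ := inv_pos.2 (by linarith [one_le_growth hμ hd h1])
  have hN : ∀ N, ∑ m ∈ range N,
      (if 2 ≤ m then m * |laceSum d β m| * μ⁻¹ ^ m else 0) ≤ ε := by
    intro N
    have hc : Continuous fun z : ℝ => ∑ m ∈ range N,
        (if 2 ≤ m then m * |laceSum d β m| * z ^ m else 0) :=
      continuous_finsetSum _ fun m _ => by split_ifs <;> fun_prop
    refine le_of_tendsto (hc.continuousWithinAt (s := Set.Iio μ⁻¹)) ?_
    filter_upwards [Ioo_mem_nhdsLT hμ0] with z hz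
    exact (H z hz.1.le hz.2).sum_laceSum_le N
  have hnn : ∀ m : ℕ, 0 ≤ (if 2 ≤ m then m * |laceSum d β m| * μ⁻¹ ^ m else 0) :=
    fun m => by positivity
  have hs := summable_of_sum_range_le hnn hN
  refine ⟨?_, Real.tsum_le_of_sum_range_le hnn hN⟩
  rw [← summable_nat_add_iff 2] at hs ⊢
  simpa using hs

lemma invSeries_critical : invSeries (laceSum d β) (μ⁻¹ : ℝ) = 0 := by
  have hμ0 : 0 < μ := by linarith [one_le_growth hμ hd h1]
  have hμi : 0 < μ⁻¹ := inv_pos.2 hμ0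
  have hc := continuousOn_invSeries (laceSum_zero (d := d) (β := β))
    (laceSum_critical hμ hd h1 H).1
  have ht : Tendsto (fun z : ℝ => ‖invSeries (laceSum d β) z‖) (𝓝[<] μ⁻¹)
      (𝓝 ‖invSeries (laceSum d β) (μ⁻¹ : ℝ)‖) := by
    refine ((hc (μ⁻¹ : ℝ) (by simp [abs_of_pos hμ0])).tendsto.comp
      (tendsto_nhdsWithin_iff.2 ⟨?_, ?_⟩)).norm
    · exact (Complex.continuous_ofReal.tendsto _).mono_left nhdsWithin_le_nhds
    · filter_upwards [Ioo_mem_nhdsLT hμi] with z hz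
      simpa [abs_of_pos hz.1] using hz.2.le
  have hb : Tendsto (fun z : ℝ => 1 - μ * z) (𝓝[<] μ⁻¹) (𝓝 (1 - μ * μ⁻¹)) :=
    (Continuous.tendsto (by fun_prop) _).mono_left nhdsWithin_le_nhds
  have hle := le_of_tendsto_of_tendsto ht hb (by
    filter_upwards [Ioo_mem_nhdsLT hμi] with z hz
    have h := hz.2
    rw [← one_div, lt_div_iff₀ hμ0, mul_comm] at h
    have hn : ‖(z : ℂ)‖ = z := by simp [abs_of_pos hz.1]
    have H' := H z hz.1.le hz.2
    rw [← hn] at H'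
    have h2 := congrArg norm H'.chi_mul_invSeries
    rw [norm_mul, norm_one] at h2
    have h3 := mul_le_mul_of_nonneg_right (inv_one_sub_le_norm_chi hμ hd h0 h1 hz.1.le hz.2)
      (norm_nonneg (invSeries (laceSum d β) z))
    rw [h2, inv_mul_le_iff₀ (by linarith), mul_one] at h3
    exact h3)
  rw [mul_inv_cancel₀ hμ0.ne', sub_self] at hle
  exact norm_le_zero_iff.1 hle

end

end WSAW

/-- properties of `F = 1/χ` on `ℤ^d` for `d > 4` and small `β`:
`χ ≠ 0` on the open disk `|z| < z_c`; `F` and `F'` extend continuously to the closed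
disk; `F(z_c) = 0`; `F' = -2d + O(β)` on the closed disk; `-z_c F'(z_c) = 1 + O(β)`;
and `|F(z)| ≥ c|1 - z/z_c|` on the closed disk. -/
theorem statement9 (d : ℕ) (hd : 4 < d) :
    ∃ β0 c C : ℝ, 0 < β0 ∧ 0 < c ∧ 0 < C ∧
      ∀ β : ℝ, 0 < β → β ≤ β0 →
        ∀ μ : ℝ, HasGrowthConst d β μ →
          (∀ z : ℂ, ‖z‖ < μ⁻¹ → chi d β z ≠ 0) ∧
          ∃ Fb Fb' : ℂ → ℂ,
            ContinuousOn Fb {z : ℂ | ‖z‖ ≤ μ⁻¹} ∧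
            ContinuousOn Fb' {z : ℂ | ‖z‖ ≤ μ⁻¹} ∧
            (∀ z : ℂ, ‖z‖ < μ⁻¹ → Fb z = (chi d β z)⁻¹) ∧
            (∀ z : ℂ, ‖z‖ < μ⁻¹ → Fb' z = deriv (fun w => (chi d β w)⁻¹) z) ∧
            Fb ((μ⁻¹ : ℝ) : ℂ) = 0 ∧
            (∀ z : ℂ, ‖z‖ ≤ μ⁻¹ → ‖Fb' z + 2 * (d : ℂ)‖ ≤ C * β) ∧
            ‖-((μ⁻¹ : ℝ) : ℂ) * Fb' ((μ⁻¹ : ℝ) : ℂ) - 1‖ ≤ C * β ∧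
            (∀ z : ℂ, ‖z‖ ≤ μ⁻¹ → c * ‖1 - z * (μ : ℂ)‖ ≤ ‖Fb z‖) := by
  open WSAW in
  have hd1 : (1 : ℝ) ≤ d := by exact_mod_cast (by omega : 1 ≤ d)
  have hG := (greenSq d).toReal_nonneg
  obtain ⟨B, hB⟩ : ∃ B, B = 64 * d ^ 2 * (greenSq d).toReal + 1 := ⟨_, rfl⟩
  obtain ⟨M, hM⟩ : ∃ M, M = (128 * d ^ 2 + 8192 * d ^ 3) * (greenSq d).toReal + 1 := ⟨_, rfl⟩
  have hB0 : 0 < B := by rw [hB]; positivity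
  have hM0 : 0 < M := by rw [hM]; positivity
  obtain ⟨D, hD⟩ : ∃ D, D = 2 * B + d * M := ⟨_, rfl⟩
  have hD0 : 0 < D := by rw [hD]; positivity
  refine ⟨(64 * d * (B + D) + 2)⁻¹, 1 / 2, 8 * d * D, by positivity, by norm_num, by positivity,
    fun β hβ hβ0 μ hμ => ?_⟩
  have hβ1 : β * (64 * d * (B + D) + 2) ≤ 1 := by
    rwa [← one_div, le_div_iff₀ (by positivity)] at hβ0
  have p1 : 0 ≤ β * (d * B) := by positivity
  have p2 : 0 ≤ β * (d * D) := by positivity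
  have p3 : β * B ≤ β * (d * B) := by
    have : B ≤ d * B := le_mul_of_one_le_left hB0.le hd1
    gcongr
  have p4 : β * D ≤ β * (d * D) := by
    have : D ≤ d * D := le_mul_of_one_le_left hD0.le hd1
    gcongr
  have h1 : β ≤ 1 / 2 := by linarith
  have h1' : β ≤ 1 := by linarith
  have hε : 16 * (d * (4 * β * D)) ≤ 1 := by linarith
  have hd0 : 0 < d := by omega
  have hμ0 : 0 < μ := by linarith [one_le_growth hμ hd0 h1']
  have hμi : 0 < μ⁻¹ := inv_pos.2 hμ0
  have hμd := growth_le hμ hβ.le h1'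
  have H : ∀ z, 0 ≤ z → z < μ⁻¹ → Perturbative d β z (4 * β * D) := fun z hz hzμ => by
    rw [hD]
    exact perturbative_of_summable hd hB.ge hM.ge hβ.le h1 (by linarith) (by rwa [← hD]) hz
      (summable_walkAct_moment hμ hd0 h1' hz hzμ)
  have hinv : ∀ z : ℂ, ‖z‖ < μ⁻¹ → chi d β z * invSeries (laceSum d β) z = 1 :=
    fun z hz => (H _ (norm_nonneg z) hz).chi_mul_invSeries
  obtain ⟨hs, hsε⟩ := laceSum_critical hμ hd0 h1' H
  have hj := laceSum_zero (d := d) (β := β)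
  have hF0 := invSeries_critical hμ hd0 hβ.le h1' H
  have heq : ∀ z : ℂ, ‖z‖ < μ⁻¹ → invSeries (laceSum d β) z = (chi d β z)⁻¹ :=
    fun z hz => eq_inv_of_mul_eq_one_right (hinv z hz)
  have hμε : μ⁻¹⁻¹ * (4 * β * D) ≤ 2 * d * (4 * β * D) := by
    rw [inv_inv]; gcongr
  have hn : ‖((μ⁻¹ : ℝ) : ℂ)‖ ≤ μ⁻¹ := by simp [abs_of_pos hμ0]
  refine ⟨fun z hz h => by simpa [h] using hinv z hz, invSeries (laceSum d β),
    invSeriesDeriv (laceSum d β), continuousOn_invSeries hj hs,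
    continuousOn_invSeriesDeriv hμi hs, heq, fun z hz => ?_, hF0, fun z hz => ?_, ?_,
    fun z hz => ?_⟩
  · have hev : (fun w => (chi d β w)⁻¹) =ᶠ[nhds z] invSeries (laceSum d β) := by
      filter_upwards [(isOpen_lt continuous_norm continuous_const).mem_nhds hz] with w hw
      exact (heq w hw).symm
    rw [hev.deriv_eq, (hasDerivAt_invSeries hμi hj hs hz).deriv]
  · have := norm_invSeriesDeriv_add_le hμi hs hsε hz
    rw [laceSum_one] at this
    push_cast at this
    linarith
  · have := norm_mul_invSeriesDeriv_le hμi hj hs hsε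
    rw [hF0, add_zero] at this
    linarith
  · have := norm_invSeries_sub_ge hμi hj hs hsε hz hn
    rw [hF0, sub_zero, laceSum_one] at this
    refine le_trans ?_ this
    have e : 1 - z * (μ : ℂ) = -((μ : ℂ) * (z - ((μ⁻¹ : ℝ) : ℂ))) := by
      have : (μ : ℂ) ≠ 0 := by exact_mod_cast hμ0.ne'
      push_cast; field_simp; ring
    rw [e, norm_neg, norm_mul, Complex.norm_real, Real.norm_of_nonneg hμ0.le, ← mul_assoc]
    gcongr
    linarith
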